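/- arXiv:1706.05074 — 8 statements merged into one kernel-verified Lean document; each statement's English description precedes it below -/
import Mathlib

section
/- Let n ≥ 1 and let A, B, C be n×n complex matrices. Let X be the (3n)×(3n) block matrix X = [[0,0,A],[C,0,0],[0,B,0]] (with n×n blocks). Then trace(X^3) = 3·trace(A·B·C). Consequently, the tensor rank of the matrix multiplication tensor M_n is at most the tensor rank of sM_{3n} viewed as a symmetric trilinear form: R(M_n) ≤ R(sM_{3n}). -/
open Filter Matrix

/-- Tensor rank of a trilinear form on a complex vector space `W`: the smallest `r`
such that `t(a,b,c) = ∑ i, f i a * g i b * h i c` for linear functionals `f i, g i, h i`. -/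
noncomputable def tensorRank {W : Type*} [AddCommGroup W] [Module ℂ W]
    (t : W → W → W → ℂ) : ℕ :=
  sInf {r : ℕ | ∃ f g h : Fin r → (W →ₗ[ℂ] ℂ),
    ∀ a b c, t a b c = ∑ i, f i a * g i b * h i c}

/-- The matrix multiplication tensor `M_n(A,B,C) = trace(ABC)`. -/
noncomputable def matMulTensor (n : ℕ) :
    Matrix (Fin n) (Fin n) ℂ → Matrix (Fin n) (Fin n) ℂ → Matrix (Fin n) (Fin n) ℂ → ℂ :=
  fun A B C => (A * B * C).trace

/-- The symmetrized matrix multiplication tensor `sM_n`, i.e. the symmetric trilinear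
form (polarization) associated to the cubic `A ↦ trace(A³)`:
`sM_n(A,B,C) = (1/2)[trace(ABC) + trace(BAC)]`. -/
noncomputable def sMTensor (n : ℕ) :
    Matrix (Fin n) (Fin n) ℂ → Matrix (Fin n) (Fin n) ℂ → Matrix (Fin n) (Fin n) ℂ → ℂ :=
  fun A B C => (1/2 : ℂ) * ((A * B * C).trace + (B * A * C).trace)

/-- The 3n×3n block matrix `[[0,0,A],[C,0,0],[0,B,0]]`. -/
noncomputable def blockX (n : ℕ) (A B C : Matrix (Fin n) (Fin n) ℂ) :
    Matrix (Fin n ⊕ Fin n ⊕ Fin n) (Fin n ⊕ Fin n ⊕ Fin n) ℂ :=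
  Matrix.of fun p q =>
    match p, q with
    | Sum.inl i, Sum.inr (Sum.inr j) => A i j
    | Sum.inr (Sum.inl i), Sum.inl j => C i j
    | Sum.inr (Sum.inr i), Sum.inr (Sum.inl j) => B i j
    | _, _ => 0

/-- Block embedding is additive and homogeneous, followed by reindexing. -/
theorem blockX_add (n : ℕ) (A B C A' B' C' : Matrix (Fin n) (Fin n) ℂ) :
    blockX n (A + A') (B + B') (C + C') = blockX n A B C + blockX n A' B' C' := by
  ext p q
  rcases p with i | i | i <;> rcases q with j | j | j <;> simp [blockX]

theorem blockX_smul (n : ℕ) (c : ℂ) (A B C : Matrix (Fin n) (Fin n) ℂ) :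
    blockX n (c • A) (c • B) (c • C) = c • blockX n A B C := by
  ext p q
  rcases p with i | i | i <;> rcases q with j | j | j <;> simp [blockX]

/-- The linear map `(A, B, C) ↦ X`, reindexed to size `3 * n`. -/
noncomputable def blockLin (n : ℕ) (e : Fin n ⊕ Fin n ⊕ Fin n ≃ Fin (3 * n)) :
    (Matrix (Fin n) (Fin n) ℂ × Matrix (Fin n) (Fin n) ℂ × Matrix (Fin n) (Fin n) ℂ) →ₗ[ℂ]
      Matrix (Fin (3 * n)) (Fin (3 * n)) ℂ where
  toFun x := (blockX n x.1 x.2.1 x.2.2).submatrix e.symm e.symm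
  map_add' x y := by
    simp only [Prod.fst_add, Prod.snd_add, blockX_add]
    rfl
  map_smul' c x := by
    simp only [Prod.smul_fst, Prod.smul_snd, blockX_smul]
    rfl

theorem trace_blockX_mul (n : ℕ) (A B C A' B' C' A'' B'' C'' : Matrix (Fin n) (Fin n) ℂ) :
    (blockX n A B C * blockX n A' B' C' * blockX n A'' B'' C'').trace
      = (A * B' * C'').trace + (C * A' * B'').trace + (B * C' * A'').trace := by
  simp [Matrix.trace, Matrix.mul_apply, blockX, Fintype.sum_sum_type, add_assoc]

theorem trace_submatrix_mul3 {m k : Type*} [Fintype m] [Fintype k] [DecidableEq m]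
    [DecidableEq k] (e : k ≃ m) (X Y Z : Matrix m m ℂ) :
    (X.submatrix e e * Y.submatrix e e * Z.submatrix e e).trace = (X * Y * Z).trace := by
  rw [Matrix.submatrix_mul_equiv, Matrix.submatrix_mul_equiv]
  simp only [Matrix.trace, Matrix.diag_apply, Matrix.submatrix_apply]
  exact e.sum_comp (fun i => (X * Y * Z) i i)

theorem sMTensor_block (n : ℕ) (e : Fin n ⊕ Fin n ⊕ Fin n ≃ Fin (3 * n))
    (A B C : Matrix (Fin n) (Fin n) ℂ) :
    matMulTensor n A B C = 2 * sMTensor (3 * n) (blockLin n e (A, 0, 0))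
      (blockLin n e (0, B, 0)) (blockLin n e (0, 0, C)) := by
  simp only [matMulTensor, sMTensor, blockLin, LinearMap.coe_mk, AddHom.coe_mk,
    trace_submatrix_mul3, trace_blockX_mul]
  simp

/-- `sM_N` has some finite decomposition, so that its rank is attained. -/
theorem sMTensor_decomp (N : ℕ) :
    {r : ℕ | ∃ f g h : Fin r → (Matrix (Fin N) (Fin N) ℂ →ₗ[ℂ] ℂ),
      ∀ a b c, sMTensor N a b c = ∑ i, f i a * g i b * h i c}.Nonempty := by
  let T := (Fin N × Fin N × Fin N) ⊕ (Fin N × Fin N × Fin N)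
  let u : Fin (Fintype.card T) ≃ T := (Fintype.equivFin T).symm
  let E : Fin N → Fin N → (Matrix (Fin N) (Fin N) ℂ →ₗ[ℂ] ℂ) :=
    fun i j => Matrix.entryLinearMap ℂ ℂ i j
  let F : T → (Matrix (Fin N) (Fin N) ℂ →ₗ[ℂ] ℂ) :=
    Sum.elim (fun t => (1/2 : ℂ) • E t.1 t.2.1) (fun t => (1/2 : ℂ) • E t.2.1 t.2.2)
  let G : T → (Matrix (Fin N) (Fin N) ℂ →ₗ[ℂ] ℂ) :=
    Sum.elim (fun t => E t.2.1 t.2.2) (fun t => E t.1 t.2.1)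
  let H : T → (Matrix (Fin N) (Fin N) ℂ →ₗ[ℂ] ℂ) :=
    Sum.elim (fun t => E t.2.2 t.1) (fun t => E t.2.2 t.1)
  have tr : ∀ a b c : Matrix (Fin N) (Fin N) ℂ, (a * b * c).trace =
      ∑ i, ∑ j, ∑ k, a i j * b j k * c k i := by
    intro a b c
    simp only [Matrix.trace, Matrix.diag_apply, Matrix.mul_apply, Finset.sum_mul]
    exact Finset.sum_congr rfl fun i _ => Finset.sum_comm
  refine ⟨Fintype.card T, F ∘ u, G ∘ u, H ∘ u, fun a b c => ?_⟩
  have := u.sum_comp (fun t => F t a * G t b * H t c)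
  simp only [Function.comp]
  rw [this]
  simp only [sMTensor, tr, T, F, G, H, E, Fintype.sum_sum_type, Fintype.sum_prod_type,
    Sum.elim_inl, Sum.elim_inr, LinearMap.smul_apply, Matrix.entryLinearMap_apply, smul_eq_mul,
    mul_add, Finset.mul_sum]
  congr 1
  · refine Finset.sum_congr rfl fun i _ => Finset.sum_congr rfl fun j _ =>
      Finset.sum_congr rfl fun k _ => ?_
    ring
  · refine Finset.sum_congr rfl fun i _ => Finset.sum_congr rfl fun j _ =>
      Finset.sum_congr rfl fun k _ => ?_
    ring

theorem trace_blockX_cube_and_rank_bound (n : ℕ) (hn : 1 ≤ n)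
    (A B C : Matrix (Fin n) (Fin n) ℂ) :
    ((blockX n A B C) ^ 3).trace = 3 * (A * B * C).trace ∧
    tensorRank (matMulTensor n) ≤ tensorRank (sMTensor (3 * n)) := by
  constructor
  · rw [pow_succ, pow_two, trace_blockX_mul, Matrix.trace_mul_cycle C A B,
      Matrix.trace_mul_cycle B C A]
    try rw [Matrix.trace_mul_cycle C A B]
    ring
  · obtain ⟨f, g, h, H⟩ := Nat.sInf_mem (sMTensor_decomp (3 * n))
    let e : Fin n ⊕ Fin n ⊕ Fin n ≃ Fin (3 * n) :=
      Fintype.equivFinOfCardEq (by simp; ring)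
    refine Nat.sInf_le ⟨
      fun i => (2 : ℂ) • (f i ∘ₗ blockLin n e ∘ₗ LinearMap.inl ℂ _ _),
      fun i => g i ∘ₗ blockLin n e ∘ₗ LinearMap.inr ℂ _ _ ∘ₗ LinearMap.inl ℂ _ _,
      fun i => h i ∘ₗ blockLin n e ∘ₗ LinearMap.inr ℂ _ _ ∘ₗ LinearMap.inr ℂ _ _,
      fun a b c => ?_⟩
    rw [sMTensor_block n e, H, Finset.mul_sum]
    refine Finset.sum_congr rfl fun i _ => ?_
    simp [mul_assoc]
    exact Or.inl rfl
end

section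
/- Let n ≥ 1 and let A, B, C be n×n complex matrices. Let X be the (3n)×(3n) block matrix X = [[0,Cᵀ,A],[C,0,Bᵀ],[Aᵀ,B,0]] (with n×n blocks). Then X is symmetric, trace(X) = 0, and trace(X^3) = 6·trace(A·B·C). Consequently, the tensor rank of the matrix multiplication tensor M_n is at most the tensor rank of sM^{S,0}_{3n} viewed as a symmetric trilinear form: R(M_n) ≤ R(sM^{S,0}_{3n}). -/
open Filter Matrix

/-- The space of traceless symmetric n×n complex matrices. -/
noncomputable def symMat0 (n : ℕ) : Submodule ℂ (Matrix (Fin n) (Fin n) ℂ) where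
  carrier := {A | Aᵀ = A ∧ A.trace = 0}
  add_mem' := by
    intro a b ha hb
    simp only [Set.mem_setOf_eq] at *
    rw [Matrix.transpose_add, Matrix.trace_add, ha.1, hb.1, ha.2, hb.2]
    simp
  zero_mem' := by simp
  smul_mem' := by
    intro c A hA
    simp only [Set.mem_setOf_eq] at *
    rw [Matrix.transpose_smul, Matrix.trace_smul, hA.1, hA.2]
    simp

/-- The symmetric trilinear form (polarization) associated to `sM^{S,0}_n`. -/
noncomputable def sMS0Tensor (n : ℕ) : symMat0 n → symMat0 n → symMat0 n → ℂ :=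
  fun A B C => (1/2 : ℂ) *
    (((A : Matrix (Fin n) (Fin n) ℂ) * B * C).trace +
      ((B : Matrix (Fin n) (Fin n) ℂ) * A * C).trace)

/-- The 3n×3n symmetric block matrix `[[0,Cᵀ,A],[C,0,Bᵀ],[Aᵀ,B,0]]`. -/
noncomputable def blockXS (n : ℕ) (A B C : Matrix (Fin n) (Fin n) ℂ) :
    Matrix (Fin n ⊕ Fin n ⊕ Fin n) (Fin n ⊕ Fin n ⊕ Fin n) ℂ :=
  Matrix.of fun p q =>
    match p, q with
    | Sum.inl i, Sum.inr (Sum.inl j) => Cᵀ i j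
    | Sum.inl i, Sum.inr (Sum.inr j) => A i j
    | Sum.inr (Sum.inl i), Sum.inl j => C i j
    | Sum.inr (Sum.inl i), Sum.inr (Sum.inr j) => Bᵀ i j
    | Sum.inr (Sum.inr i), Sum.inl j => Aᵀ i j
    | Sum.inr (Sum.inr i), Sum.inr (Sum.inl j) => B i j
    | _, _ => 0

lemma blockXS_eq_fromBlocks (n : ℕ) (A B C : Matrix (Fin n) (Fin n) ℂ) :
    blockXS n A B C = Matrix.fromBlocks 0 (Matrix.fromCols Cᵀ A) (Matrix.fromRows C Aᵀ)
      (Matrix.fromBlocks 0 Bᵀ B 0) := by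
  ext (i | i | i) (j | j | j) <;> simp [blockXS]

lemma blockXS_transpose (n : ℕ) (A B C : Matrix (Fin n) (Fin n) ℂ) :
    (blockXS n A B C)ᵀ = blockXS n A B C := by
  ext (i | i | i) (j | j | j) <;> simp [blockXS]

lemma blockXS_trace (n : ℕ) (A B C : Matrix (Fin n) (Fin n) ℂ) :
    (blockXS n A B C).trace = 0 := by
  simp [blockXS, Matrix.trace]

/-- Trace of the product of three block matrices. -/
lemma blockXS_trace_mul (n : ℕ) (A B C A₂ B₂ C₂ A₃ B₃ C₃ : Matrix (Fin n) (Fin n) ℂ) :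
    (blockXS n A B C * blockXS n A₂ B₂ C₂ * blockXS n A₃ B₃ C₃).trace =
      (A * B₂ * C₃).trace + (B * C₂ * A₃).trace + (C * A₂ * B₃).trace +
      (Cᵀ * B₂ᵀ * A₃ᵀ).trace + (Bᵀ * A₂ᵀ * C₃ᵀ).trace + (Aᵀ * C₂ᵀ * B₃ᵀ).trace := by
  simp only [Matrix.trace, Matrix.diag, Matrix.mul_apply, Fintype.sum_sum_type, blockXS,
    Matrix.of_apply, mul_zero, zero_mul, Finset.sum_const_zero, add_zero, zero_add,
    Finset.sum_add_distrib]
  ring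

lemma trace_transpose_three (n : ℕ) (A B C : Matrix (Fin n) (Fin n) ℂ) :
    (Aᵀ * Bᵀ * Cᵀ).trace = (C * B * A).trace := by
  rw [← Matrix.trace_transpose, Matrix.transpose_mul, Matrix.transpose_mul]
  simp [Matrix.mul_assoc]

/-- The embedding as a function into the traceless symmetric matrices. -/
noncomputable def embXS (n : ℕ) (e : Fin n ⊕ Fin n ⊕ Fin n ≃ Fin (3 * n))
    (A B C : Matrix (Fin n) (Fin n) ℂ) : symMat0 (3 * n) :=
  ⟨(blockXS n A B C).submatrix e.symm e.symm, by
    constructor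
    · rw [Matrix.transpose_submatrix, blockXS_transpose]
    · rw [← blockXS_trace n A B C]
      exact Equiv.sum_comp e.symm (fun i => blockXS n A B C i i)⟩

lemma trace_submatrix_three {m k : Type*} [Fintype m] [Fintype k]
    (e : k ≃ m) (X Y Z : Matrix m m ℂ) :
    (X.submatrix e e * Y.submatrix e e * Z.submatrix e e).trace = (X * Y * Z).trace := by
  rw [Matrix.submatrix_mul_equiv, Matrix.submatrix_mul_equiv]
  exact Equiv.sum_comp e (fun i => (X * Y * Z) i i)

lemma sMS0_emb (n : ℕ) (e : Fin n ⊕ Fin n ⊕ Fin n ≃ Fin (3 * n))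
    (A B C : Matrix (Fin n) (Fin n) ℂ) :
    sMS0Tensor (3 * n) (embXS n e A 0 0) (embXS n e 0 B 0) (embXS n e 0 0 C) =
      matMulTensor n A B C := by
  simp only [sMS0Tensor, embXS, matMulTensor, trace_submatrix_three, blockXS_trace_mul,
    trace_transpose_three]
  simp only [Matrix.mul_zero, Matrix.zero_mul, Matrix.trace_zero]
  rw [Matrix.mul_assoc C A B, Matrix.trace_mul_comm C (A * B)]
  ring

/-- Linear embedding in the first slot. -/
noncomputable def embA (n : ℕ) (e : Fin n ⊕ Fin n ⊕ Fin n ≃ Fin (3 * n)) :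
    Matrix (Fin n) (Fin n) ℂ →ₗ[ℂ] symMat0 (3 * n) where
  toFun A := embXS n e A 0 0
  map_add' A B := by
    apply Subtype.ext
    ext i j
    simp only [embXS, Submodule.coe_add, Matrix.add_apply, Matrix.submatrix_apply]
    rcases e.symm i with (i | i | i) <;> rcases e.symm j with (j | j | j) <;> simp [blockXS]
  map_smul' c A := by
    apply Subtype.ext
    ext i j
    simp only [embXS, Submodule.coe_smul, Matrix.smul_apply, Matrix.submatrix_apply]
    rcases e.symm i with (i | i | i) <;> rcases e.symm j with (j | j | j) <;> simp [blockXS]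

/-- Linear embedding in the second slot. -/
noncomputable def embB (n : ℕ) (e : Fin n ⊕ Fin n ⊕ Fin n ≃ Fin (3 * n)) :
    Matrix (Fin n) (Fin n) ℂ →ₗ[ℂ] symMat0 (3 * n) where
  toFun A := embXS n e 0 A 0
  map_add' A B := by
    apply Subtype.ext
    ext i j
    simp only [embXS, Submodule.coe_add, Matrix.add_apply, Matrix.submatrix_apply]
    rcases e.symm i with (i | i | i) <;> rcases e.symm j with (j | j | j) <;> simp [blockXS]
  map_smul' c A := by
    apply Subtype.ext
    ext i j
    simp only [embXS, Submodule.coe_smul, Matrix.smul_apply, Matrix.submatrix_apply]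
    rcases e.symm i with (i | i | i) <;> rcases e.symm j with (j | j | j) <;> simp [blockXS]

/-- Linear embedding in the third slot. -/
noncomputable def embC (n : ℕ) (e : Fin n ⊕ Fin n ⊕ Fin n ≃ Fin (3 * n)) :
    Matrix (Fin n) (Fin n) ℂ →ₗ[ℂ] symMat0 (3 * n) where
  toFun A := embXS n e 0 0 A
  map_add' A B := by
    apply Subtype.ext
    ext i j
    simp only [embXS, Submodule.coe_add, Matrix.add_apply, Matrix.submatrix_apply]
    rcases e.symm i with (i | i | i) <;> rcases e.symm j with (j | j | j) <;> simp [blockXS]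
  map_smul' c A := by
    apply Subtype.ext
    ext i j
    simp only [embXS, Submodule.coe_smul, Matrix.smul_apply, Matrix.submatrix_apply]
    rcases e.symm i with (i | i | i) <;> rcases e.symm j with (j | j | j) <;> simp [blockXS]

/-- The coordinate functionals on traceless symmetric matrices. -/
noncomputable def entryXS (N : ℕ) (i j : Fin N) : symMat0 N →ₗ[ℂ] ℂ where
  toFun A := (A : Matrix (Fin N) (Fin N) ℂ) i j
  map_add' _ _ := rfl
  map_smul' _ _ := rfl

lemma entryXS_apply (N : ℕ) (i j : Fin N) (A : symMat0 N) :
    entryXS N i j A = (A : Matrix (Fin N) (Fin N) ℂ) i j := rfl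

/-- The tensor rank of `sMS0Tensor` is attained: some finite decomposition exists. -/
lemma sMS0_decomp (N : ℕ) : {r : ℕ | ∃ f g h : Fin r → (symMat0 N →ₗ[ℂ] ℂ),
    ∀ a b c, sMS0Tensor N a b c = ∑ i, f i a * g i b * h i c}.Nonempty := by
  let ι := (Fin N × Fin N × Fin N) ⊕ (Fin N × Fin N × Fin N)
  let E := (Fintype.equivFin ι).symm
  let F : ι → (symMat0 N →ₗ[ℂ] ℂ) := Sum.elim (fun p => (1/2 : ℂ) • entryXS N p.1 p.2.2)
    (fun p => (1/2 : ℂ) • entryXS N p.2.2 p.2.1)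
  let G : ι → (symMat0 N →ₗ[ℂ] ℂ) := Sum.elim (fun p => entryXS N p.2.2 p.2.1)
    (fun p => entryXS N p.1 p.2.2)
  let H : ι → (symMat0 N →ₗ[ℂ] ℂ) := Sum.elim (fun p => entryXS N p.2.1 p.1)
    (fun p => entryXS N p.2.1 p.1)
  refine ⟨Fintype.card ι, fun i => F (E i), fun i => G (E i), fun i => H (E i), ?_⟩
  intro a b c
  rw [Equiv.sum_comp E (fun i => F i a * G i b * H i c)]
  simp only [ι, F, G, H, Fintype.sum_sum_type, Fintype.sum_prod_type, Sum.elim_inl, Sum.elim_inr,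
    entryXS_apply, LinearMap.smul_apply, smul_eq_mul, sMS0Tensor,
    Matrix.trace, Matrix.diag, Matrix.mul_apply, Finset.sum_mul, mul_add, Finset.mul_sum]
  congr 1 <;>
  · refine Finset.sum_congr rfl fun i _ => Finset.sum_congr rfl fun j _ =>
      Finset.sum_congr rfl fun k _ => ?_
    ring

theorem blockXS_symm_traceless_trace_cube_and_rank_bound (n : ℕ) (hn : 1 ≤ n)
    (A B C : Matrix (Fin n) (Fin n) ℂ) :
    (blockXS n A B C)ᵀ = blockXS n A B C ∧
    (blockXS n A B C).trace = 0 ∧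
    ((blockXS n A B C) ^ 3).trace = 6 * (A * B * C).trace ∧
    tensorRank (matMulTensor n) ≤ tensorRank (sMS0Tensor (3 * n)) := by
  refine ⟨blockXS_transpose n A B C, blockXS_trace n A B C, ?_, ?_⟩
  · rw [pow_three', blockXS_trace_mul]
    simp only [trace_transpose_three]
    rw [Matrix.mul_assoc C A B, Matrix.trace_mul_comm C (A * B),
      Matrix.trace_mul_comm (B * C) A, Matrix.mul_assoc A B C]
    ring
  · let e : Fin n ⊕ Fin n ⊕ Fin n ≃ Fin (3 * n) :=
      Fintype.equivFinOfCardEq (by simp; ring)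
    obtain ⟨f, g, h, hfgh⟩ := Nat.sInf_mem (sMS0_decomp (3 * n))
    refine Nat.sInf_le ⟨fun i => f i ∘ₗ embA n e, fun i => g i ∘ₗ embB n e,
      fun i => h i ∘ₗ embC n e, ?_⟩
    intro a b c
    rw [← sMS0_emb n e a b c]
    exact hfgh _ _ _
end

section
/- The following limits inferior (as n → ∞, with log_n x = ln x / ln n) all coincide: liminf_n log_n R(M_n) = liminf_n log_n R(sM_n) = liminf_n log_n R_s(sM_n). In other words, the exponent of matrix multiplication can be computed from either the tensor rank or the symmetric rank of the symmetrized matrix multiplication polynomial sM_n. -/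
open Filter Matrix

/-- Symmetric (Waring) rank of a cubic polynomial: the smallest `r` such that
`P = ℓ₁³ + ⋯ + ℓᵣ³` for linear forms `ℓᵢ`. -/
noncomputable def symRank {W : Type*} [AddCommGroup W] [Module ℂ W]
    (P : W → ℂ) : ℕ :=
  sInf {r : ℕ | ∃ ℓ : Fin r → (W →ₗ[ℂ] ℂ), ∀ a, P a = ∑ i, (ℓ i a) ^ 3}

/-- The symmetrized matrix multiplication polynomial `sM_n(A) = trace(A³)`. -/
noncomputable def sMPoly (n : ℕ) : Matrix (Fin n) (Fin n) ℂ → ℂ := fun A => (A ^ 3).trace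

def HasRk {W : Type*} [AddCommGroup W] [Module ℂ W] (t : W → W → W → ℂ) (r : ℕ) : Prop :=
  ∃ f g h : Fin r → (W →ₗ[ℂ] ℂ), ∀ a b c, t a b c = ∑ i, f i a * g i b * h i c

def HasSym {W : Type*} [AddCommGroup W] [Module ℂ W] (P : W → ℂ) (r : ℕ) : Prop :=
  ∃ ℓ : Fin r → (W →ₗ[ℂ] ℂ), ∀ a, P a = ∑ i, (ℓ i a) ^ 3

lemma hasRk_of_fintype {W ι : Type*} [AddCommGroup W] [Module ℂ W] [Fintype ι]
    (t : W → W → W → ℂ) (f g h : ι → (W →ₗ[ℂ] ℂ))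
    (H : ∀ a b c, t a b c = ∑ i, f i a * g i b * h i c) : HasRk t (Fintype.card ι) := by
  let e := (Fintype.equivFin ι).symm
  refine ⟨fun i => f (e i), fun i => g (e i), fun i => h (e i), fun a b c => ?_⟩
  rw [H, ← e.sum_comp]

lemma hasSym_of_fintype {W ι : Type*} [AddCommGroup W] [Module ℂ W] [Fintype ι]
    (P : W → ℂ) (f : ι → (W →ₗ[ℂ] ℂ))
    (H : ∀ a, P a = ∑ i, (f i a) ^ 3) : HasSym P (Fintype.card ι) := by
  let e := (Fintype.equivFin ι).symm
  refine ⟨fun i => f (e i), fun a => ?_⟩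
  rw [H, ← e.sum_comp]

lemma hasRk_matMul (n : ℕ) : HasRk (matMulTensor n) (n ^ 3) := by
  have := hasRk_of_fintype (ι := Fin n × Fin n × Fin n) (matMulTensor n)
    (fun p => Matrix.entryLinearMap ℂ ℂ p.1 p.2.1)
    (fun p => Matrix.entryLinearMap ℂ ℂ p.2.1 p.2.2)
    (fun p => Matrix.entryLinearMap ℂ ℂ p.2.2 p.1) (by
      intro a b c
      simp only [matMulTensor, Matrix.trace, Matrix.diag, Matrix.mul_apply,
        Fintype.sum_prod_type, Matrix.entryLinearMap_apply, Finset.sum_mul]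
      exact Finset.sum_congr rfl fun i _ => Finset.sum_comm)
  convert this using 1
  simp; ring

lemma hasSym_sM (n r : ℕ) (H : HasRk (matMulTensor n) r) : HasSym (sMPoly n) (4 * r) := by
  obtain ⟨f, g, h, H⟩ := H
  obtain ⟨c, hc⟩ : ∃ c : ℂ, c ^ 3 = 1 / 24 := IsAlgClosed.exists_pow_nat_eq _ (by norm_num)
  have := hasSym_of_fintype (ι := Fin r × Fin 4) (sMPoly n)
    (fun p => c • (![f p.1 + g p.1 + h p.1, -f p.1 - g p.1 + h p.1,
      f p.1 - g p.1 - h p.1, -f p.1 + g p.1 - h p.1] p.2)) (by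
      intro a
      have h1 : sMPoly n a = matMulTensor n a a a := by
        simp only [sMPoly, matMulTensor, pow_succ, pow_zero, one_mul]
      rw [h1, H, Fintype.sum_prod_type]
      refine Finset.sum_congr rfl fun i _ => ?_
      simp [Fin.sum_univ_four, mul_pow, hc]
      ring)
  convert this using 1
  simp; ring

lemma hasRk_sM (n r : ℕ) (H : HasSym (sMPoly n) r) : HasRk (sMTensor n) r := by
  obtain ⟨l, H⟩ := H
  refine ⟨l, l, l, fun a b c => ?_⟩
  have key : 6 * sMTensor n a b c = sMPoly n (a + b + c) - sMPoly n (a + b) - sMPoly n (a + c)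
      - sMPoly n (b + c) + sMPoly n a + sMPoly n b + sMPoly n c := by
    have e1 : (b * c * a).trace = (a * b * c).trace := by
      rw [Matrix.trace_mul_comm, ← Matrix.mul_assoc]
    have e2 : (c * a * b).trace = (a * b * c).trace := by
      rw [Matrix.mul_assoc, Matrix.trace_mul_comm]
    have e3 : (a * c * b).trace = (b * a * c).trace := by
      rw [Matrix.trace_mul_comm, ← Matrix.mul_assoc]
    have e4 : (c * b * a).trace = (b * a * c).trace := by
      rw [Matrix.mul_assoc, Matrix.trace_mul_comm]
    simp only [sMPoly, sMTensor, pow_succ, pow_zero, one_mul, add_mul, mul_add, Matrix.trace_add,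
      e1, e2, e3, e4]
    ring
  have : 6 * sMTensor n a b c = 6 * ∑ i, l i a * l i b * l i c := by
    rw [key]
    simp only [H, map_add, Finset.mul_sum, ← Finset.sum_sub_distrib, ← Finset.sum_add_distrib]
    exact Finset.sum_congr rfl fun i _ => by ring
  exact mul_left_cancel₀ (by norm_num) this

lemma hasRk_mat_of_sM (k n r : ℕ) (hk : 3 * k ≤ n) (H : HasRk (sMTensor n) r) :
    HasRk (matMulTensor k) r := by
  obtain ⟨f, g, h, H⟩ := H
  let P : Fin 3 → Matrix (Fin n) (Fin k) ℂ := fun j =>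
    Matrix.of fun x y => if x.val = j.val * k + y.val then 1 else 0
  have hP : ∀ i j, (P i)ᵀ * P j = if i = j then 1 else 0 := by
    intro i j
    ext x y
    have hx : i.val * k + x.val < n := by
      have := i.isLt; have := x.isLt; nlinarith
    have : ((P i)ᵀ * P j) x y = if i.val * k + x.val = j.val * k + y.val then 1 else 0 := by
      simp only [Matrix.mul_apply, P, Matrix.transpose_apply, Matrix.of_apply]
      rw [Finset.sum_eq_single (⟨i.val * k + x.val, hx⟩ : Fin n)]
      · simp
      · intro b _ hb
        rw [if_neg, zero_mul]
        intro h; exact hb (Fin.ext h)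
      · simp
    rw [this]
    have hiff : i.val * k + x.val = j.val * k + y.val ↔ i = j ∧ x = y := by
      constructor
      · intro h
        have hx := x.isLt
        have hy := y.isLt
        have hk0 : 0 < k := by omega
        have h1 : (i.val * k + x.val) / k = i.val := by
          rw [mul_comm, Nat.mul_add_div hk0, Nat.div_eq_of_lt hx]; rfl
        have h2 : (j.val * k + y.val) / k = j.val := by
          rw [mul_comm, Nat.mul_add_div hk0, Nat.div_eq_of_lt hy]; rfl
        have h3 : i = j := Fin.ext (by rw [← h1, ← h2, h])
        subst h3
        exact ⟨rfl, Fin.ext (by omega)⟩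
      · rintro ⟨rfl, rfl⟩; rfl
    simp only [hiff]
    by_cases hij : i = j <;> simp [hij, Matrix.one_apply]
  let T : Fin 3 → Fin 3 → Matrix (Fin k) (Fin k) ℂ →ₗ[ℂ] Matrix (Fin n) (Fin n) ℂ := fun i j =>
    { toFun := fun A => P i * A * (P j)ᵀ
      map_add' := fun A B => by rw [Matrix.mul_add, Matrix.add_mul]
      map_smul' := fun c A => by simp }
  have hT : ∀ i j A, T i j A = P i * A * (P j)ᵀ := fun _ _ _ => rfl
  have hmul : ∀ i j l m A B, T i j A * T l m B = if j = l then T i m (A * B) else 0 := by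
    intro i j l m A B
    have : T i j A * T l m B = P i * A * ((P j)ᵀ * P l) * B * (P m)ᵀ := by
      simp only [hT, Matrix.mul_assoc]
    rw [this, hP]
    split_ifs
    · simp [hT, Matrix.mul_assoc]
    · simp
  have htr : ∀ i A, (T i i A).trace = A.trace := by
    intro i A
    rw [hT, Matrix.trace_mul_comm, ← Matrix.mul_assoc, hP]; simp
  refine ⟨fun i => (2:ℂ) • (f i).comp (T 0 1), fun i => (g i).comp (T 1 2),
    fun i => (h i).comp (T 2 0), fun a b c => ?_⟩
  have := H (T 0 1 a) (T 1 2 b) (T 2 0 c)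
  have e : matMulTensor k a b c = 2 * sMTensor n (T 0 1 a) (T 1 2 b) (T 2 0 c) := by
    simp [matMulTensor, sMTensor, hmul, htr]
  rw [e, this, Finset.mul_sum]
  exact Finset.sum_congr rfl fun i _ => by simp; ring

lemma spec_a (n : ℕ) : HasRk (matMulTensor n) (tensorRank (matMulTensor n)) :=
  Nat.sInf_mem (s := {r | HasRk (matMulTensor n) r}) ⟨_, hasRk_matMul n⟩

lemma spec_c (n : ℕ) : HasSym (sMPoly n) (symRank (sMPoly n)) :=
  Nat.sInf_mem (s := {r | HasSym (sMPoly n) r}) ⟨_, hasSym_sM n _ (hasRk_matMul n)⟩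

lemma spec_b (n : ℕ) : HasRk (sMTensor n) (tensorRank (sMTensor n)) :=
  Nat.sInf_mem (s := {r | HasRk (sMTensor n) r}) ⟨_, hasRk_sM n _ (spec_c n)⟩

lemma a_le (n : ℕ) : tensorRank (matMulTensor n) ≤ n ^ 3 := Nat.sInf_le (hasRk_matMul n)

lemma c_le (n : ℕ) : symRank (sMPoly n) ≤ 4 * tensorRank (matMulTensor n) :=
  Nat.sInf_le (hasSym_sM n _ (spec_a n))

lemma b_le (n : ℕ) : tensorRank (sMTensor n) ≤ symRank (sMPoly n) :=
  Nat.sInf_le (hasRk_sM n _ (spec_c n))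

lemma a_le_b (n : ℕ) : tensorRank (matMulTensor (n / 3)) ≤ tensorRank (sMTensor n) :=
  Nat.sInf_le (hasRk_mat_of_sM (n / 3) n _ (by omega) (spec_b n))

lemma log_nat_mono {a b : ℕ} (h : a ≤ b) : Real.log a ≤ Real.log b := by
  rcases Nat.eq_zero_or_pos a with rfl | ha
  · simpa using Real.log_natCast_nonneg b
  · exact Real.log_le_log (by exact_mod_cast ha) (by exact_mod_cast h)

lemma log_nat_mul_le (a b : ℕ) : Real.log ((a * b : ℕ) : ℝ) ≤ Real.log a + Real.log b := by
  rcases Nat.eq_zero_or_pos a with rfl | ha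
  · simpa using Real.log_natCast_nonneg b
  rcases Nat.eq_zero_or_pos b with rfl | hb
  · simpa using Real.log_natCast_nonneg a
  push_cast
  rw [Real.log_mul] <;> positivity

/-- The analytic part. -/
lemma liminf_aux (x y : ℕ → ℝ) (K : ℝ) (hx : ∀ n, 0 ≤ x n) (hy : ∀ n, 0 ≤ y n)
    (hyK : ∀ᶠ n in atTop, y n ≤ K) (h : ∀ ε > 0, ∀ᶠ n in atTop, x n ≤ y n + ε) :
    liminf x atTop ≤ liminf y atTop := by
  refine le_of_forall_pos_le_add fun ε hε => ?_
  have hb : IsBoundedUnder (· ≥ ·) atTop y := isBoundedUnder_of ⟨0, hy⟩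
  have hc : IsCoboundedUnder (· ≥ ·) atTop y :=
    IsBoundedUnder.isCoboundedUnder_ge ⟨K, hyK⟩
  rw [← liminf_add_const atTop y ε hc hb]
  refine liminf_le_liminf (h ε hε) (isBoundedUnder_of ⟨0, hx⟩) ?_
  exact IsBoundedUnder.isCoboundedUnder_ge ⟨K + ε, by
    simp only [eventually_map]; filter_upwards [hyK] with n hn; linarith⟩

theorem liminf_log_rank_sM_eq :
    Filter.liminf (fun n : ℕ => Real.log (tensorRank (matMulTensor n)) / Real.log n) atTop =
      Filter.liminf (fun n : ℕ => Real.log (tensorRank (sMTensor n)) / Real.log n) atTop ∧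
    Filter.liminf (fun n : ℕ => Real.log (tensorRank (matMulTensor n)) / Real.log n) atTop =
      Filter.liminf (fun n : ℕ => Real.log (symRank (sMPoly n)) / Real.log n) atTop := by
  set u := fun n : ℕ => Real.log (tensorRank (matMulTensor n)) / Real.log n with hu
  set v := fun n : ℕ => Real.log (tensorRank (sMTensor n)) / Real.log n with hv
  set w := fun n : ℕ => Real.log (symRank (sMPoly n)) / Real.log n with hw
  have hlog : Tendsto (fun n : ℕ => Real.log n) atTop atTop :=
    Real.tendsto_log_atTop.comp tendsto_natCast_atTop_atTop
  have hdiv : Tendsto (fun n : ℕ => n / 3) atTop atTop :=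
    Nat.tendsto_div_const_atTop (by norm_num)
  have u0 : ∀ n, 0 ≤ u n := fun n =>
    div_nonneg (Real.log_natCast_nonneg _) (Real.log_natCast_nonneg _)
  have v0 : ∀ n, 0 ≤ v n := fun n =>
    div_nonneg (Real.log_natCast_nonneg _) (Real.log_natCast_nonneg _)
  have w0 : ∀ n, 0 ≤ w n := fun n =>
    div_nonneg (Real.log_natCast_nonneg _) (Real.log_natCast_nonneg _)
  have hu3 : ∀ᶠ n in atTop, u n ≤ 3 := by
    filter_upwards [hlog.eventually_gt_atTop 0] with n hn
    rw [hu]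
    simp only
    rw [div_le_iff₀ hn]
    have := log_nat_mono (a_le n)
    push_cast at this
    rwa [Real.log_pow] at this
  have hwu : ∀ ε > 0, ∀ᶠ n in atTop, w n ≤ u n + ε := by
    intro ε hε
    filter_upwards [hlog.eventually_gt_atTop 0, hlog.eventually_ge_atTop (Real.log 4 / ε)]
      with n hn hn2
    have h1 := (log_nat_mono (c_le n)).trans (log_nat_mul_le _ _)
    have h2 : Real.log 4 ≤ Real.log n * ε := (div_le_iff₀ hε).1 hn2
    simp only [hw, hu]
    rw [div_add' _ _ _ hn.ne', div_le_div_iff_of_pos_right hn]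
    push_cast at h1
    linarith
  have hvw : ∀ n, v n ≤ w n := fun n =>
    div_le_div_of_nonneg_right (log_nat_mono (b_le n)) (Real.log_natCast_nonneg _)
  have hw4 : ∀ᶠ n in atTop, w n ≤ 4 := by
    filter_upwards [hu3, hwu 1 one_pos] with n h1 h2
    linarith
  have hv4 : ∀ᶠ n in atTop, v n ≤ 4 := by
    filter_upwards [hw4] with n h1
    linarith [hvw n]
  have L1 : liminf v atTop ≤ liminf w atTop :=
    liminf_aux v w 4 v0 w0 hw4 fun ε hε => .of_forall fun n => by linarith [hvw n]
  have L2 : liminf w atTop ≤ liminf u atTop := liminf_aux w u 3 w0 u0 hu3 hwu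
  have L3 : liminf u atTop ≤ liminf v atTop := by
    have A : liminf u atTop ≤ liminf (fun n => u (n / 3)) atTop := by
      have : liminf (fun n => u (n / 3)) atTop = liminf u (map (fun n => n / 3) atTop) := rfl
      rw [this]
      refine liminf_le_liminf_of_le hdiv (isBoundedUnder_of ⟨0, u0⟩) ?_
      exact IsBoundedUnder.isCoboundedUnder_ge ⟨3, by
        simp only [eventually_map]; exact hdiv.eventually hu3⟩
    refine A.trans (liminf_aux _ v 4 (fun n => u0 _) v0 hv4 ?_)
    intro ε hε
    filter_upwards [hv4, hlog.eventually_gt_atTop 0, (hlog.comp hdiv).eventually_gt_atTop 0,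
      (hlog.comp hdiv).eventually_ge_atTop (4 * Real.log 5 / ε), eventually_ge_atTop 3]
      with n h4 hn hk hk2 hn3
    simp only [Function.comp] at hk hk2
    have h1 : Real.log n ≤ Real.log 5 + Real.log (n / 3 : ℕ) := by
      have : n ≤ 5 * (n / 3) := by omega
      have := (log_nat_mono this).trans (log_nat_mul_le _ _)
      exact_mod_cast this
    have h2 := log_nat_mono (a_le_b n)
    have h3 : Real.log (tensorRank (sMTensor n)) = v n * Real.log n := by
      simp only [hv]; field_simp
    have h5 : 4 * Real.log 5 ≤ Real.log (n / 3 : ℕ) * ε := (div_le_iff₀ hε).1 hk2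
    have h6 : 0 ≤ Real.log 5 := Real.log_nonneg (by norm_num)
    simp only [hu]
    rw [div_le_iff₀ hk]
    nlinarith [v0 n, mul_le_mul_of_nonneg_left h1 (v0 n), mul_le_mul_of_nonneg_right h4 h6]
  exact ⟨le_antisymm L3 (L1.trans L2), le_antisymm (L3.trans L1) L2⟩
end

section
/- The following limits inferior (as n → ∞, with log_n x = ln x / ln n) all coincide: liminf_n log_n uR(M_n) = liminf_n log_n uR(sM_n) = liminf_n log_n uR_s(sM_n). In other words, the exponent of matrix multiplication can be computed from either the border rank or the symmetric border rank of the symmetrized matrix multiplication polynomial sM_n. -/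
open Filter Matrix

/-- Border rank of a trilinear form: the smallest `r` such that `t` is a limit of
trilinear forms of tensor rank at most `r` (pointwise convergence, which on the
finite-dimensional space of trilinear forms agrees with the usual topology). -/
noncomputable def borderRank {W : Type*} [AddCommGroup W] [Module ℂ W]
    (t : W → W → W → ℂ) : ℕ :=
  sInf {r : ℕ | ∃ f g h : ℕ → Fin r → (W →ₗ[ℂ] ℂ),
    ∀ a b c, Tendsto (fun m => ∑ i, f m i a * g m i b * h m i c) atTop (nhds (t a b c))}

/-- Symmetric border rank of a cubic polynomial: the smallest `r` such that `P` is a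
limit of cubics of symmetric rank at most `r` (pointwise convergence, which on the
finite-dimensional space of cubics agrees with the usual topology). -/
noncomputable def symBorderRank {W : Type*} [AddCommGroup W] [Module ℂ W]
    (P : W → ℂ) : ℕ :=
  sInf {r : ℕ | ∃ ℓ : ℕ → Fin r → (W →ₗ[ℂ] ℂ),
    ∀ a, Tendsto (fun m => ∑ i, (ℓ m i a) ^ 3) atTop (nhds (P a))}

lemma borderRank_le_card {W : Type*} [AddCommGroup W] [Module ℂ W]
    (t : W → W → W → ℂ) {ι : Type*} [Fintype ι] (f g h : ℕ → ι → (W →ₗ[ℂ] ℂ))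
    (H : ∀ a b c, Tendsto (fun m => ∑ i, f m i a * g m i b * h m i c) atTop (nhds (t a b c))) :
    borderRank t ≤ Fintype.card ι := by
  apply Nat.sInf_le
  let e := (Fintype.equivFin ι).symm
  refine ⟨fun m i => f m (e i), fun m i => g m (e i), fun m i => h m (e i), fun a b c => ?_⟩
  have := H a b c
  refine this.congr fun m => ?_
  exact (e.sum_comp (fun i => f m i a * g m i b * h m i c)).symm

lemma symBorderRank_le_card {W : Type*} [AddCommGroup W] [Module ℂ W]
    (P : W → ℂ) {ι : Type*} [Fintype ι] (l : ℕ → ι → (W →ₗ[ℂ] ℂ))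
    (H : ∀ a, Tendsto (fun m => ∑ i, (l m i a) ^ 3) atTop (nhds (P a))) :
    symBorderRank P ≤ Fintype.card ι := by
  apply Nat.sInf_le
  let e := (Fintype.equivFin ι).symm
  refine ⟨fun m i => l m (e i), fun a => ?_⟩
  refine (H a).congr fun m => ?_
  exact (e.sum_comp (fun i => (l m i a) ^ 3)).symm

/-- The coordinate functional of a matrix. -/
noncomputable def coordFun (n : ℕ) (i j : Fin n) : Matrix (Fin n) (Fin n) ℂ →ₗ[ℂ] ℂ where
  toFun A := A i j
  map_add' _ _ := rfl
  map_smul' _ _ := rfl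

lemma matMul_witness (n : ℕ) (a b c : Matrix (Fin n) (Fin n) ℂ) :
    ∑ p : Fin n × Fin n × Fin n, coordFun n p.1 p.2.1 a * coordFun n p.2.1 p.2.2 b *
      coordFun n p.2.2 p.1 c = matMulTensor n a b c := by
  simp only [matMulTensor, Matrix.trace, Matrix.diag, Matrix.mul_apply, coordFun,
    Fintype.sum_prod_type, LinearMap.coe_mk, Finset.sum_mul]
  refine Finset.sum_congr rfl fun i _ => ?_
  rw [Finset.sum_comm]
  rfl

lemma matMul_le (n : ℕ) : borderRank (matMulTensor n) ≤ n ^ 3 := by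
  have := borderRank_le_card (matMulTensor n) (ι := Fin n × Fin n × Fin n)
    (fun _ p => coordFun n p.1 p.2.1) (fun _ p => coordFun n p.2.1 p.2.2)
    (fun _ p => coordFun n p.2.2 p.1)
    (fun a b c => by simp only [matMul_witness]; exact tendsto_const_nhds)
  refine this.trans (le_of_eq ?_)
  simp [Fintype.card_prod]; ring

lemma matMul_mem (n : ℕ) : ∃ f g h : ℕ → Fin (borderRank (matMulTensor n)) →
      (Matrix (Fin n) (Fin n) ℂ →ₗ[ℂ] ℂ),
    ∀ a b c, Tendsto (fun m => ∑ i, f m i a * g m i b * h m i c) atTop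
      (nhds (matMulTensor n a b c)) := by
  refine Nat.sInf_mem (s := {r : ℕ | ∃ f g h : ℕ → Fin r →
      (Matrix (Fin n) (Fin n) ℂ →ₗ[ℂ] ℂ),
    ∀ a b c, Tendsto (fun m => ∑ i, f m i a * g m i b * h m i c) atTop
      (nhds (matMulTensor n a b c))}) ?_
  let e := (Fintype.equivFin (Fin n × Fin n × Fin n)).symm
  refine ⟨_, fun _ i => coordFun n (e i).1 (e i).2.1,
    fun _ i => coordFun n (e i).2.1 (e i).2.2, fun _ i => coordFun n (e i).2.2 (e i).1,
    fun a b c => ?_⟩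
  have := (e.sum_comp (fun p => coordFun n p.1 p.2.1 a *
    coordFun n p.2.1 p.2.2 b * coordFun n p.2.2 p.1 c)).trans (matMul_witness n a b c)
  exact tendsto_const_nhds.congr fun _ => this.symm

/-- A product of three linear forms as a sum of four cubes. -/
noncomputable def cubeForm {W : Type*} [AddCommGroup W] [Module ℂ W] (z : ℂ)
    (x y w : W →ₗ[ℂ] ℂ) : Fin 4 → (W →ₗ[ℂ] ℂ) :=
  ![z • (x + y + w), (-z) • (x + y - w), (-z) • (x - y + w), z • (x - y - w)]

lemma cubeForm_sum {W : Type*} [AddCommGroup W] [Module ℂ W] (z : ℂ) (hz : z ^ 3 = 1 / 24)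
    (x y w : W →ₗ[ℂ] ℂ) (a : W) : ∑ j, (cubeForm z x y w j a) ^ 3 = x a * y a * w a := by
  simp only [cubeForm, Fin.sum_univ_four, Matrix.cons_val, LinearMap.smul_apply,
    LinearMap.add_apply, LinearMap.sub_apply, smul_eq_mul]
  linear_combination (24 * x a * y a * w a) * hz

lemma sym_witness (n : ℕ) : ∃ l : ℕ → Fin (borderRank (matMulTensor n)) × Fin 4 →
      (Matrix (Fin n) (Fin n) ℂ →ₗ[ℂ] ℂ),
    ∀ a, Tendsto (fun m => ∑ i, (l m i a) ^ 3) atTop (nhds (sMPoly n a)) := by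
  obtain ⟨f, g, h, H⟩ := matMul_mem n
  obtain ⟨z, hz⟩ := IsAlgClosed.exists_pow_nat_eq (1 / 24 : ℂ) (n := 3) (by norm_num)
  refine ⟨fun m p => cubeForm z (f m p.1) (g m p.1) (h m p.1) p.2, fun a => ?_⟩
  have h1 : sMPoly n a = matMulTensor n a a a := by
    simp [sMPoly, matMulTensor, pow_succ]
  rw [h1]
  refine (H a a a).congr fun m => ?_
  rw [Fintype.sum_prod_type]
  exact Finset.sum_congr rfl fun i _ => (cubeForm_sum z hz _ _ _ a).symm

lemma sym_le (n : ℕ) : symBorderRank (sMPoly n) ≤ 4 * borderRank (matMulTensor n) := by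
  obtain ⟨l, H⟩ := sym_witness n
  have := symBorderRank_le_card _ l H
  simpa [Fintype.card_prod, mul_comm] using this

lemma sym_mem (n : ℕ) : ∃ l : ℕ → Fin (symBorderRank (sMPoly n)) →
      (Matrix (Fin n) (Fin n) ℂ →ₗ[ℂ] ℂ),
    ∀ a, Tendsto (fun m => ∑ i, (l m i a) ^ 3) atTop (nhds (sMPoly n a)) := by
  refine Nat.sInf_mem (s := {r : ℕ | ∃ l : ℕ → Fin r →
      (Matrix (Fin n) (Fin n) ℂ →ₗ[ℂ] ℂ),
    ∀ a, Tendsto (fun m => ∑ i, (l m i a) ^ 3) atTop (nhds (sMPoly n a))}) ?_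
  obtain ⟨l, H⟩ := sym_witness n
  let e := (Fintype.equivFin (Fin (borderRank (matMulTensor n)) × Fin 4)).symm
  refine ⟨_, fun m i => l m (e i), fun a => ?_⟩
  refine (H a).congr fun m => ?_
  exact (e.sum_comp (fun i => (l m i a) ^ 3)).symm

lemma sM_polar (n : ℕ) (a b c : Matrix (Fin n) (Fin n) ℂ) :
    sMTensor n a b c = (1 / 24 : ℂ) * (sMPoly n (a + b + c) - sMPoly n (a + b - c)
      - sMPoly n (a - b + c) + sMPoly n (a - b - c)) := by
  have e1 : (b * c * a).trace = (a * b * c).trace := by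
    rw [Matrix.trace_mul_cycle]
  have e2 : (c * a * b).trace = (a * b * c).trace := by
    rw [Matrix.trace_mul_cycle, Matrix.trace_mul_cycle]
  have e3 : (a * c * b).trace = (b * a * c).trace := by
    rw [Matrix.trace_mul_cycle]
  have e4 : (c * b * a).trace = (b * a * c).trace := by
    rw [Matrix.trace_mul_cycle, Matrix.trace_mul_cycle]
  have c1 : (a * a * b).trace = (a * b * a).trace := by
    rw [Matrix.trace_mul_cycle, Matrix.trace_mul_cycle]
  have c2 : (b * a * a).trace = (a * b * a).trace := by
    rw [Matrix.trace_mul_cycle]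
  have c3 : (a * a * c).trace = (a * c * a).trace := by
    rw [Matrix.trace_mul_cycle, Matrix.trace_mul_cycle]
  have c4 : (c * a * a).trace = (a * c * a).trace := by
    rw [Matrix.trace_mul_cycle]
  simp only [sMTensor, sMPoly, pow_succ, pow_zero, one_mul, add_mul, mul_add, sub_mul, mul_sub,
    Matrix.trace_add, Matrix.trace_sub, e1, e2, e3, e4, c1, c2, c3, c4]
  ring

lemma sM_mem' (n : ℕ) : ∃ f g h : ℕ → Fin (symBorderRank (sMPoly n)) →
      (Matrix (Fin n) (Fin n) ℂ →ₗ[ℂ] ℂ),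
    ∀ a b c, Tendsto (fun m => ∑ i, f m i a * g m i b * h m i c) atTop
      (nhds (sMTensor n a b c)) := by
  obtain ⟨l, H⟩ := sym_mem n
  refine ⟨l, l, l, fun a b c => ?_⟩
  rw [sM_polar]
  refine (((((H (a + b + c)).sub (H (a + b - c))).sub (H (a - b + c))).add
    (H (a - b - c))).const_mul (1 / 24 : ℂ)).congr fun m => ?_
  rw [← Finset.sum_sub_distrib, ← Finset.sum_sub_distrib, ← Finset.sum_add_distrib,
    Finset.mul_sum]
  refine Finset.sum_congr rfl fun i _ => ?_
  simp only [map_add, map_sub]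
  ring

lemma sM_le_sym (n : ℕ) : borderRank (sMTensor n) ≤ symBorderRank (sMPoly n) :=
  Nat.sInf_le (sM_mem' n)

lemma sM_mem (n : ℕ) : ∃ f g h : ℕ → Fin (borderRank (sMTensor n)) →
      (Matrix (Fin n) (Fin n) ℂ →ₗ[ℂ] ℂ),
    ∀ a b c, Tendsto (fun m => ∑ i, f m i a * g m i b * h m i c) atTop
      (nhds (sMTensor n a b c)) :=
  Nat.sInf_mem (s := {r : ℕ | ∃ f g h : ℕ → Fin r →
      (Matrix (Fin n) (Fin n) ℂ →ₗ[ℂ] ℂ),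
    ∀ a b c, Tendsto (fun m => ∑ i, f m i a * g m i b * h m i c) atTop
      (nhds (sMTensor n a b c))}) ⟨_, sM_mem' n⟩

/-- The linear map `A ↦ P A Q`. -/
noncomputable def sandwich {k n : ℕ} (P : Matrix (Fin n) (Fin k) ℂ)
    (Q : Matrix (Fin k) (Fin n) ℂ) :
    Matrix (Fin k) (Fin k) ℂ →ₗ[ℂ] Matrix (Fin n) (Fin n) ℂ where
  toFun A := P * A * Q
  map_add' A B := by rw [Matrix.mul_add, Matrix.add_mul]
  map_smul' c A := by simp

lemma exists_blocks {k n : ℕ} (h : 3 * k ≤ n) :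
    ∃ (P : Fin 3 → Matrix (Fin n) (Fin k) ℂ) (Q : Fin 3 → Matrix (Fin k) (Fin n) ℂ),
      (∀ s, Q s * P s = 1) ∧ ∀ s t, s ≠ t → Q s * P t = 0 := by
  have hlt : ∀ (s : Fin 3) (i : Fin k), (s : ℕ) * k + i < n := by
    intro s i
    have := i.2
    have hs : (s : ℕ) * k ≤ 2 * k := Nat.mul_le_mul_right _ (by omega)
    omega
  let e : Fin 3 → Fin k → Fin n := fun s i => ⟨s * k + i, hlt s i⟩
  have key : ∀ s t, (1 : Matrix (Fin n) (Fin n) ℂ).submatrix (e s) id *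
      (1 : Matrix (Fin n) (Fin n) ℂ).submatrix id (e t) =
      (1 : Matrix (Fin n) (Fin n) ℂ).submatrix (e s) (e t) := by
    intro s t
    rw [← Matrix.submatrix_mul _ _ _ _ _ Function.bijective_id, Matrix.one_mul]
  refine ⟨fun s => (1 : Matrix (Fin n) (Fin n) ℂ).submatrix id (e s),
    fun s => (1 : Matrix (Fin n) (Fin n) ℂ).submatrix (e s) id, fun s => ?_, fun s t hst => ?_⟩
  · rw [key]
    refine Matrix.submatrix_one _ fun i j hij => ?_
    simp only [e, Fin.mk.injEq] at hij
    exact Fin.ext (by omega)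
  · rw [key]
    ext i j
    have : e s i ≠ e t j := by
      intro hij
      simp only [e, Fin.mk.injEq] at hij
      have hi := i.2
      have hj := j.2
      apply hst
      fin_cases s <;> fin_cases t <;> simp at hij ⊢ <;> omega
    simp [Matrix.one_apply_ne this]

lemma matMul_le_sM {k n : ℕ} (h : 3 * k ≤ n) :
    borderRank (matMulTensor k) ≤ borderRank (sMTensor n) := by
  obtain ⟨f, g, hh, H⟩ := sM_mem n
  obtain ⟨P, Q, h1, h0⟩ := exists_blocks h
  refine Nat.sInf_le ⟨fun m i => (2 : ℂ) • (f m i ∘ₗ sandwich (P 0) (Q 1)),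
    fun m i => g m i ∘ₗ sandwich (P 1) (Q 2), fun m i => hh m i ∘ₗ sandwich (P 2) (Q 0),
    fun a b c => ?_⟩
  have e : matMulTensor k a b c = 2 * sMTensor n (sandwich (P 0) (Q 1) a)
      (sandwich (P 1) (Q 2) b) (sandwich (P 2) (Q 0) c) := by
    have z1 : (P 0 * a * Q 1) * (P 1 * b * Q 2) * (P 2 * c * Q 0) = P 0 * (a * b * c * Q 0) := by
      calc _ = P 0 * (a * ((Q 1 * P 1) * (b * ((Q 2 * P 2) * (c * Q 0))))) := by
            simp only [Matrix.mul_assoc]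
        _ = _ := by rw [h1, h1]; simp only [Matrix.mul_assoc, Matrix.one_mul]
    have z2 : (P 1 * b * Q 2) * (P 0 * a * Q 1) * (P 2 * c * Q 0) = 0 := by
      calc _ = P 1 * (b * ((Q 2 * P 0) * (a * ((Q 1 * P 2) * (c * Q 0))))) := by
            simp only [Matrix.mul_assoc]
        _ = _ := by rw [h0 2 0 (by decide)]; simp
    simp only [matMulTensor, sMTensor, sandwich, LinearMap.coe_mk, AddHom.coe_mk]
    rw [z1, z2, Matrix.trace_mul_comm (P 0), Matrix.mul_assoc (a * b * c), h1]
    simp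
  rw [e]
  refine ((H _ _ _).const_mul (2 : ℂ)).congr fun m => ?_
  rw [Finset.mul_sum]
  refine Finset.sum_congr rfl fun i _ => ?_
  simp only [LinearMap.smul_apply, LinearMap.comp_apply, smul_eq_mul]
  ring

lemma liminf_le_liminf_of_approx (u v e : ℕ → ℝ) (φ : ℕ → ℕ) (C : ℝ)
    (hφ : Tendsto φ atTop atTop) (he : Tendsto e atTop (nhds 0))
    (hu : ∀ n, 0 ≤ u n) (hv : ∀ n, v n ≤ C)
    (h : ∀ᶠ n in atTop, u (φ n) ≤ v n + e n) :
    liminf u atTop ≤ liminf v atTop := by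
  refine le_of_forall_pos_le_add fun ε hε => ?_
  have hub : IsBoundedUnder (· ≥ ·) atTop u := isBoundedUnder_of ⟨0, hu⟩
  have hvc : IsCoboundedUnder (· ≥ ·) atTop v :=
    (isBoundedUnder_of ⟨C, hv⟩ : IsBoundedUnder (· ≤ ·) atTop v).isCoboundedUnder_ge
  have h1 : ∀ᶠ n in atTop, liminf u atTop - ε / 2 < u n :=
    eventually_lt_of_lt_liminf (by linarith) hub
  have h2 : ∀ᶠ n in atTop, e n < ε / 2 := he.eventually_lt_const (by linarith)
  have : liminf u atTop - ε ≤ liminf v atTop := by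
    refine le_liminf_of_le hvc ?_
    filter_upwards [hφ.eventually h1, h2, h] with n a b c
    linarith
  linarith

lemma ratio_nonneg (a n : ℕ) : 0 ≤ Real.log a / Real.log n :=
  div_nonneg (Real.log_natCast_nonneg _) (Real.log_natCast_nonneg _)

lemma ratio_mono {a b : ℕ} (n : ℕ) (h : a ≤ b) :
    Real.log a / Real.log n ≤ Real.log b / Real.log n :=
  div_le_div_of_nonneg_right (log_nat_mono h) (Real.log_natCast_nonneg _)

lemma sym_ratio_le (n : ℕ) :
    Real.log (symBorderRank (sMPoly n)) / Real.log n ≤ 5 := by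
  rcases Nat.lt_or_ge n 2 with hn | hn
  · interval_cases n <;> simp
  · have h1 : symBorderRank (sMPoly n) ≤ n ^ 5 := by
      calc _ ≤ 4 * n ^ 3 := (sym_le n).trans (Nat.mul_le_mul_left _ (matMul_le n))
        _ ≤ n ^ 2 * n ^ 3 := Nat.mul_le_mul_right _ (by nlinarith)
        _ = n ^ 5 := by ring
    have hl : 0 < Real.log n := Real.log_pos (by exact_mod_cast hn)
    rw [div_le_iff₀ hl]
    have := log_nat_mono h1
    rw [Nat.cast_pow, Real.log_pow] at this
    exact_mod_cast this

lemma tendsto_const_div_log (c : ℝ) :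
    Tendsto (fun n : ℕ => c / Real.log n) atTop (nhds 0) :=
  Tendsto.div_atTop tendsto_const_nhds (Real.tendsto_log_atTop.comp tendsto_natCast_atTop_atTop)

lemma liminf_bc : liminf (fun n : ℕ => Real.log (borderRank (sMTensor n)) / Real.log n) atTop ≤
    liminf (fun n : ℕ => Real.log (symBorderRank (sMPoly n)) / Real.log n) atTop :=
  liminf_le_liminf_of_approx _ _ (fun _ => 0) id 5 tendsto_id tendsto_const_nhds
    (fun n => ratio_nonneg _ n) sym_ratio_le
    (Eventually.of_forall fun n => by simpa using ratio_mono n (sM_le_sym n))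

lemma liminf_ca :
    liminf (fun n : ℕ => Real.log (symBorderRank (sMPoly n)) / Real.log n) atTop ≤
    liminf (fun n : ℕ => Real.log (borderRank (matMulTensor n)) / Real.log n) atTop := by
  refine liminf_le_liminf_of_approx _ _ (fun n : ℕ => Real.log 4 / Real.log n) id 3 tendsto_id
    (tendsto_const_div_log _) (fun n => ratio_nonneg _ n) ?_ (Eventually.of_forall fun n => ?_)
  · intro n
    rcases Nat.lt_or_ge n 2 with hn | hn
    · interval_cases n <;> simp
    · have hl : 0 < Real.log n := Real.log_pos (by exact_mod_cast hn)
      rw [div_le_iff₀ hl]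
      have := log_nat_mono (matMul_le n)
      rw [Nat.cast_pow, Real.log_pow] at this
      exact_mod_cast this
  · have h4 : (0 : ℝ) ≤ Real.log 4 := Real.log_nonneg (by norm_num)
    simp only [id]
    rw [← add_div]
    refine div_le_div_of_nonneg_right ?_ (Real.log_natCast_nonneg _)
    have h := log_nat_mono (sym_le n)
    rcases Nat.eq_zero_or_pos (borderRank (matMulTensor n)) with h0 | h0
    · rw [h0] at h ⊢
      simp at h ⊢
      linarith
    · rw [Nat.cast_mul, Real.log_mul (by norm_num) (by positivity)] at h
      push_cast at h
      linarith

lemma liminf_ab :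
    liminf (fun n : ℕ => Real.log (borderRank (matMulTensor n)) / Real.log n) atTop ≤
    liminf (fun n : ℕ => Real.log (borderRank (sMTensor n)) / Real.log n) atTop := by
  have hφ : Tendsto (fun n : ℕ => n / 3) atTop atTop :=
    Nat.tendsto_div_const_atTop (by norm_num)
  have hb : ∀ n : ℕ, Real.log (borderRank (sMTensor n)) / Real.log n ≤ 5 :=
    fun n => (ratio_mono n (sM_le_sym n)).trans (sym_ratio_le n)
  refine liminf_le_liminf_of_approx _ _
    (fun n : ℕ => (5 * Real.log 5) / Real.log ((n / 3 : ℕ) : ℝ)) (fun n => n / 3) 5 hφ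
    ((tendsto_const_div_log _).comp hφ) (fun n => ratio_nonneg _ n) hb ?_
  filter_upwards [eventually_ge_atTop 6] with n hn
  have hk : 2 ≤ n / 3 := by omega
  have h3 : 3 * (n / 3) ≤ n := by omega
  have h5 : n ≤ 5 * (n / 3) := by omega
  have hab := log_nat_mono (matMul_le_sM h3)
  have hln := log_nat_mono h5
  generalize n / 3 = k at *
  have hkl : 0 < Real.log k := Real.log_pos (by exact_mod_cast hk)
  have hnl : 0 < Real.log n := Real.log_pos (by exact_mod_cast (by omega : 1 < n))
  have hk0 : (k : ℝ) ≠ 0 := by positivity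
  rw [Nat.cast_mul, Real.log_mul (by norm_num) hk0] at hln
  push_cast at hln
  have hb0 := ratio_nonneg (borderRank (sMTensor n)) n
  have hbn := hb n
  have heq : Real.log (borderRank (sMTensor n)) =
    Real.log (borderRank (sMTensor n)) / Real.log n * Real.log n := by field_simp
  generalize Real.log (borderRank (sMTensor n)) / Real.log n = x at *
  rw [div_le_iff₀ hkl, add_mul, div_mul_cancel₀ _ hkl.ne']
  have h5' : (0 : ℝ) ≤ Real.log 5 := Real.log_nonneg (by norm_num)
  have := mul_le_mul_of_nonneg_left hln hb0
  have := mul_le_mul_of_nonneg_right hbn h5'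
  linarith

theorem liminf_log_borderRank_sM_eq :
    Filter.liminf (fun n : ℕ => Real.log (borderRank (matMulTensor n)) / Real.log n) atTop =
      Filter.liminf (fun n : ℕ => Real.log (borderRank (sMTensor n)) / Real.log n) atTop ∧
    Filter.liminf (fun n : ℕ => Real.log (borderRank (matMulTensor n)) / Real.log n) atTop =
      Filter.liminf (fun n : ℕ => Real.log (symBorderRank (sMPoly n)) / Real.log n) atTop :=
  by
  exact ⟨le_antisymm liminf_ab (liminf_bc.trans liminf_ca),
    le_antisymm (liminf_ab.trans liminf_bc) liminf_ca⟩
end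

section
/- Suppose L_1, ..., L_k are n×n complex matrices such that trace(A^3) = Σ_{i=1}^k (trace(L_iᵀ A))^3 for every n×n complex matrix A (a symmetric rank decomposition of sM_n). If n = 2, then there exists i with rank(L_i) = 2. If n ≥ 3, then max_i rank(L_i) ≥ 3. -/
open Filter Matrix

theorem waring_polar {n k : ℕ}
    (L : Fin k → Matrix (Fin n) (Fin n) ℂ)
    (h : ∀ A : Matrix (Fin n) (Fin n) ℂ,
      (A ^ 3).trace = ∑ i, ((L i)ᵀ * A).trace ^ 3) (X Y Z : Matrix (Fin n) (Fin n) ℂ) :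
    2 * ∑ i, ((L i)ᵀ * X).trace * ((L i)ᵀ * Y).trace * ((L i)ᵀ * Z).trace
      = (X * Y * Z).trace + (X * Z * Y).trace := by
  have e1 : ∑ i, (((L i)ᵀ * (X + Y + Z)).trace ^ 3 - ((L i)ᵀ * (X + Y)).trace ^ 3
      - ((L i)ᵀ * (X + Z)).trace ^ 3 - ((L i)ᵀ * (Y + Z)).trace ^ 3
      + ((L i)ᵀ * X).trace ^ 3 + ((L i)ᵀ * Y).trace ^ 3 + ((L i)ᵀ * Z).trace ^ 3)
      = 6 * ∑ i, ((L i)ᵀ * X).trace * ((L i)ᵀ * Y).trace * ((L i)ᵀ * Z).trace := by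
    rw [Finset.mul_sum]
    refine Finset.sum_congr rfl fun i _ => ?_
    simp only [Matrix.mul_add, Matrix.trace_add]
    ring
  simp only [Finset.sum_add_distrib, Finset.sum_sub_distrib, ← h] at e1
  have e2 : (X + Y + Z) ^ 3 - (X + Y) ^ 3 - (X + Z) ^ 3 - (Y + Z) ^ 3 + X ^ 3 + Y ^ 3 + Z ^ 3
      = X * Y * Z + X * Z * Y + Y * X * Z + Y * Z * X + Z * X * Y + Z * Y * X := by
    noncomm_ring
  have e3 := congrArg Matrix.trace e2
  simp only [Matrix.trace_add, Matrix.trace_sub] at e3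
  have c1 := Matrix.trace_mul_cycle X Y Z
  have c2 := Matrix.trace_mul_cycle Y Z X
  have c3 := Matrix.trace_mul_cycle X Z Y
  have c4 := Matrix.trace_mul_cycle Z Y X
  linear_combination (1/3) * (e3 - e1) - (1/3) * c1 + (1/3) * c2 - (1/3) * c3 + (1/3) * c4

theorem waring_entries {n k : ℕ}
    (L : Fin k → Matrix (Fin n) (Fin n) ℂ)
    (h : ∀ A : Matrix (Fin n) (Fin n) ℂ,
      (A ^ 3).trace = ∑ i, ((L i)ᵀ * A).trace ^ 3) (p q r s t u : Fin n) :
    ∑ i, L i p q * L i r s * L i t u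
      = ((if q = r ∧ s = t ∧ u = p then 1 else 0)
        + (if q = t ∧ u = r ∧ s = p then 1 else 0)) / 2 := by
  have := waring_polar L h (Matrix.single p q 1) (Matrix.single r s 1) (Matrix.single t u 1)
  have key : ∀ p q r s t u : Fin n, (Matrix.single p q (1:ℂ) * Matrix.single r s 1
      * Matrix.single t u 1).trace = if q = r ∧ s = t ∧ u = p then 1 else 0 := by
    intro p q r s t u
    by_cases h1 : q = r
    · subst h1
      by_cases h2 : s = t
      · subst h2
        by_cases h3 : u = p
        · subst h3; simp
        · simp [h3, Matrix.trace_single_eq_of_ne, Ne.symm h3]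
      · simp [h2]
    · simp [h1]
  simp only [key, Matrix.trace_mul_single, Matrix.transpose_apply] at this
  simp only [MulOpposite.op_one, one_smul, mul_one] at this
  rw [← this]; ring

/-- In any symmetric rank decomposition `trace(A³) = ∑ᵢ trace(Lᵢᵀ A)³` of `sM_n`:
for `n = 2` some `Lᵢ` has rank exactly 2, and for `n ≥ 3` some `Lᵢ` has rank at least 3. -/
theorem rank_of_summands_in_waring_decomposition (n k : ℕ)
    (L : Fin k → Matrix (Fin n) (Fin n) ℂ)
    (hdecomp : ∀ A : Matrix (Fin n) (Fin n) ℂ,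
      (A ^ 3).trace = ∑ i, ((L i)ᵀ * A).trace ^ 3) :
    (n = 2 → ∃ i, (L i).rank = 2) ∧ (3 ≤ n → ∃ i, 3 ≤ (L i).rank) := by
  have E := waring_entries L hdecomp
  constructor
  · rintro rfl
    have hs : ∑ i, (L i).det * L i 0 0 ≠ 0 := by
      have : ∑ i, (L i).det * L i 0 0 = ∑ i, L i 0 0 * L i 1 1 * L i 0 0
          - ∑ i, L i 0 1 * L i 1 0 * L i 0 0 := by
        rw [← Finset.sum_sub_distrib]
        refine Finset.sum_congr rfl fun i _ => ?_
        rw [Matrix.det_fin_two]; ring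
      rw [this, E, E]; norm_num
    obtain ⟨i, -, hi⟩ := Finset.exists_ne_zero_of_sum_ne_zero hs
    refine ⟨i, ?_⟩
    have := Matrix.rank_of_isUnit (L i)
      ((Matrix.isUnit_iff_isUnit_det _).2 (left_ne_zero_of_mul hi).isUnit)
    simpa using this
  · intro hn
    obtain ⟨f, hf⟩ : ∃ f : Fin 3 → Fin n, Function.Injective f :=
      ⟨Fin.castLE hn, Fin.castLE_injective hn⟩
    have hs : ∑ i, ((L i).submatrix f f).det ≠ 0 := by
      simp only [Matrix.det_fin_three, Matrix.submatrix_apply, Finset.sum_add_distrib,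
        Finset.sum_sub_distrib, E, hf.eq_iff]
      norm_num [show (0 : Fin 3) ≠ 2 by decide, show (1 : Fin 3) ≠ 2 by decide,
        show (2 : Fin 3) ≠ 1 by decide]
    obtain ⟨i, -, hi⟩ := Finset.exists_ne_zero_of_sum_ne_zero hs
    refine ⟨i, ?_⟩
    have := Matrix.rank_of_isUnit ((L i).submatrix f f)
      ((Matrix.isUnit_iff_isUnit_det _).2 hi.isUnit)
    have h3 : ((L i).submatrix f f).rank = 3 := by simpa using this
    rw [← h3]
    exact Matrix.rank_submatrix_le _ _ _
end

section
/- For every n ≥ 1, the symmetric (Waring) rank of the symmetrized matrix multiplication polynomial satisfies R_s(sM_n) ≤ 8·C(n,3) + 4·C(n,2) + n, where C(n,k) denotes the binomial coefficient. -/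
open Filter Matrix

/-- `P` is a sum of exactly `r` cubes of linear forms. -/
def IsCubeSum {W : Type*} [AddCommGroup W] [Module ℂ W] (P : W → ℂ) (r : ℕ) : Prop :=
  ∃ ℓ : Fin r → (W →ₗ[ℂ] ℂ), ∀ a, P a = ∑ i, (ℓ i a) ^ 3

theorem IsCubeSum.add {W : Type*} [AddCommGroup W] [Module ℂ W] {P Q : W → ℂ} {r s : ℕ}
    (hP : IsCubeSum P r) (hQ : IsCubeSum Q s) : IsCubeSum (fun a => P a + Q a) (r + s) := by
  obtain ⟨l, hl⟩ := hP
  obtain ⟨m, hm⟩ := hQ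
  refine ⟨Fin.append l m, fun a => ?_⟩
  simp [Fin.sum_univ_add, hl, hm]

theorem IsCubeSum.sum {W ι : Type*} [AddCommGroup W] [Module ℂ W] (s : Finset ι)
    (F : ι → W → ℂ) (r : ℕ) (h : ∀ i, IsCubeSum (F i) r) :
    IsCubeSum (fun a => ∑ i ∈ s, F i a) (s.card * r) := by
  classical
  induction s using Finset.induction_on with
  | empty =>
    simp only [Finset.card_empty, Nat.zero_mul]
    exact ⟨Fin.elim0, fun a => by simp⟩
  | insert i s hi ih =>
    have := ih.add (h i)
    rw [Finset.card_insert_of_notMem hi, Nat.succ_mul]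
    simpa only [Finset.sum_insert hi, add_comm] using this

theorem IsCubeSum.comp {V W : Type*} [AddCommGroup W] [Module ℂ W] [AddCommGroup V] [Module ℂ V]
    {P : W → ℂ} {r : ℕ} (h : IsCubeSum P r) (f : V →ₗ[ℂ] W) :
    IsCubeSum (fun a => P (f a)) r := by
  obtain ⟨l, hl⟩ := h
  exact ⟨fun i => (l i).comp f, fun a => by simp [hl]⟩

theorem isCubeSum_cube {W : Type*} [AddCommGroup W] [Module ℂ W] (x : W →ₗ[ℂ] ℂ) :
    IsCubeSum (fun a => x a ^ 3) 1 := ⟨fun _ => x, fun a => by simp⟩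

theorem isCubeSum_mul {W : Type*} [AddCommGroup W] [Module ℂ W] (x y z : W →ₗ[ℂ] ℂ) :
    IsCubeSum (fun a => 3 * (x a * y a * z a)) 4 := by
  refine ⟨![(1/2 : ℂ) • (x + y + z), (1/2 : ℂ) • (x - y - z), (1/2 : ℂ) • (y - x - z),
    (1/2 : ℂ) • (z - x - y)], fun a => ?_⟩
  simp [Fin.sum_univ_four]
  ring

theorem sMPoly_eq_sum (n : ℕ) (A : Matrix (Fin n) (Fin n) ℂ) :
    sMPoly n A = ∑ i, ∑ j, ∑ k, A i j * A j k * A k i := by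
  simp only [sMPoly, pow_succ, pow_zero, one_mul, Matrix.trace, Matrix.diag, Matrix.mul_apply,
    Finset.sum_mul]
  exact Finset.sum_congr rfl fun i _ => Finset.sum_comm

/-- Recursion: split off the index `0`. -/
theorem sMPoly_succ (n : ℕ) (A : Matrix (Fin (n + 1)) (Fin (n + 1)) ℂ) :
    sMPoly (n + 1) A = sMPoly n (A.submatrix Fin.succ Fin.succ) + A 0 0 ^ 3 +
      ∑ p : Fin n × Fin n, 3 * (A 0 p.1.succ *
        (A p.1.succ p.2.succ + if p.1 = p.2 then A 0 0 else 0) * A p.2.succ 0) := by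
  have h1 : ∑ i : Fin n, ∑ j : Fin n, A i.succ 0 * A 0 j.succ * A j.succ i.succ
      = ∑ i : Fin n, ∑ j : Fin n, A 0 i.succ * A i.succ j.succ * A j.succ 0 := by
    rw [Finset.sum_comm]
    exact Finset.sum_congr rfl fun i _ => Finset.sum_congr rfl fun j _ => by ring
  have h2 : ∑ i : Fin n, ∑ j : Fin n, A i.succ j.succ * A j.succ 0 * A 0 i.succ
      = ∑ i : Fin n, ∑ j : Fin n, A 0 i.succ * A i.succ j.succ * A j.succ 0 :=
    Finset.sum_congr rfl fun i _ => Finset.sum_congr rfl fun j _ => by ring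
  have h3 : ∑ i : Fin n, A 0 0 * A 0 i.succ * A i.succ 0
      = ∑ i : Fin n, A 0 i.succ * A 0 0 * A i.succ 0 :=
    Finset.sum_congr rfl fun i _ => by ring
  have h4 : ∑ i : Fin n, A 0 i.succ * A i.succ 0 * A 0 0
      = ∑ i : Fin n, A 0 i.succ * A 0 0 * A i.succ 0 :=
    Finset.sum_congr rfl fun i _ => by ring
  have h5 : ∑ i : Fin n, A i.succ 0 * A 0 0 * A 0 i.succ
      = ∑ i : Fin n, A 0 i.succ * A 0 0 * A i.succ 0 :=
    Finset.sum_congr rfl fun i _ => by ring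
  simp only [sMPoly_eq_sum, Fin.sum_univ_succ, Finset.sum_add_distrib, Fintype.sum_prod_type,
    ← Finset.mul_sum, mul_add, add_mul, mul_ite, ite_mul, mul_zero, zero_mul,
    Finset.sum_ite_eq, Finset.mem_univ, if_true, Matrix.submatrix_apply]
  simp only [h1, h2, h3, h4, h5]
  ring

theorem isCubeSum_sMPoly (n : ℕ) :
    IsCubeSum (sMPoly n) (8 * n.choose 3 + 4 * n.choose 2 + n) := by
  induction n with
  | zero => exact ⟨fun _ => 0, fun a => by simp [sMPoly, Matrix.trace]⟩
  | succ n ih =>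
    let e : Fin (n + 1) → Fin (n + 1) → (Matrix (Fin (n + 1)) (Fin (n + 1)) ℂ →ₗ[ℂ] ℂ) :=
      fun i j => Matrix.entryLinearMap ℂ ℂ i j
    let f : Matrix (Fin (n + 1)) (Fin (n + 1)) ℂ →ₗ[ℂ] Matrix (Fin n) (Fin n) ℂ :=
      { toFun := fun A => A.submatrix Fin.succ Fin.succ
        map_add' := fun _ _ => rfl
        map_smul' := fun _ _ => rfl }
    have key := ((ih.comp f).add (isCubeSum_cube (e 0 0))).add
      (IsCubeSum.sum (Finset.univ : Finset (Fin n × Fin n)) _ 4 fun p =>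
        isCubeSum_mul (e 0 p.1.succ)
          (e p.1.succ p.2.succ + if p.1 = p.2 then e 0 0 else 0) (e p.2.succ 0))
    have hc : 8 * (n + 1).choose 3 + 4 * (n + 1).choose 2 + (n + 1)
        = 8 * n.choose 3 + 4 * n.choose 2 + n + 1
          + (Finset.univ : Finset (Fin n × Fin n)).card * 4 := by
      have h2 : n.choose 2 * 2 + n = n * n := by
        clear * -
        induction n with
        | zero => rfl
        | succ k ihk =>
          rw [Nat.choose_succ_succ' k 1, Nat.choose_one_right]
          linarith
      simp only [Finset.card_univ, Fintype.card_prod, Fintype.card_fin, Nat.choose_succ_succ' n 2,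
        Nat.choose_succ_succ' n 1, Nat.choose_one_right, Nat.reduceAdd]
      omega
    rw [hc]
    convert key using 1
    funext A
    rw [sMPoly_succ]
    congr 1
    refine Finset.sum_congr rfl fun p _ => ?_
    split_ifs <;> simp [e]

theorem symRank_sMPoly_le (n : ℕ) (hn : 1 ≤ n) :
    symRank (sMPoly n) ≤ 8 * n.choose 3 + 4 * n.choose 2 + n := by
  exact Nat.sInf_le (isCubeSum_sMPoly n)
end

section
/- For every n ≥ 3, the polynomial sM_n(A) = trace(A^3), viewed as a polynomial in the n² entries of the matrix A over ℂ, is irreducible. -/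
open Filter Matrix

/-- `trace(A³)` as a polynomial in the n² matrix entries:
`∑_{i,j,k} x_{ij} x_{jk} x_{ki}`. -/
noncomputable def sMMvPoly (n : ℕ) : MvPolynomial (Fin n × Fin n) ℂ :=
  ∑ i : Fin n, ∑ j : Fin n, ∑ k : Fin n,
    MvPolynomial.X (i, j) * MvPolynomial.X (j, k) * MvPolynomial.X (k, i)

/-- Specialised matrix: a weighted 3-cycle plus a loop. -/
noncomputable def specMat (n : ℕ) (p : Fin n × Fin n) : MvPolynomial (Fin 4) ℂ :=
  if p.1.val = 0 ∧ p.2.val = 1 then MvPolynomial.X 0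
  else if p.1.val = 1 ∧ p.2.val = 2 then MvPolynomial.X 1
  else if p.1.val = 2 ∧ p.2.val = 0 then MvPolynomial.X 2
  else if p.1.val = 0 ∧ p.2.val = 0 then MvPolynomial.X 3
  else 0

/-- The specialised cubic. -/
noncomputable def specCubic : MvPolynomial (Fin 4) ℂ :=
  MvPolynomial.C 3 * MvPolynomial.X 1 * MvPolynomial.X 2 * MvPolynomial.X 0 +
    MvPolynomial.X 3 ^ 3

lemma aeval_specMat (n : ℕ) (hn : 3 ≤ n) :
    MvPolynomial.aeval (specMat n) (sMMvPoly n) = specCubic := by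
  obtain ⟨m, rfl⟩ : ∃ m, n = m + 3 := ⟨n - 3, by omega⟩
  have h2 : 2 % (m + 3) = 2 := Nat.mod_eq_of_lt (by omega)
  simp [sMMvPoly, specMat, specCubic, Fin.sum_univ_succ, h2]
  rw [show (MvPolynomial.C (3 : ℂ) : MvPolynomial (Fin 4) ℂ) = 3 from map_ofNat _ 3]
  ring

lemma isRelPrime_X {i j : Fin 4} (h : i ≠ j) :
    IsRelPrime (MvPolynomial.X i : MvPolynomial (Fin 4) ℂ) (MvPolynomial.X j) := by
  rw [(MvPolynomial.X_prime (i := i)).irreducible.isRelPrime_iff_not_dvd, MvPolynomial.X_dvd_X]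
  simpa using h

lemma specCubic_irreducible : Irreducible specCubic := by
  classical
  have hC : IsUnit (MvPolynomial.C (3 : ℂ) : MvPolynomial (Fin 4) ℂ) :=
    (IsUnit.mk0 (3 : ℂ) (by norm_num)).map MvPolynomial.C
  apply MvPolynomial.irreducible_mul_X_add
  · simp
  · intro h
    have h := MvPolynomial.vars_mul _ _ h
    rw [Finset.mem_union] at h
    rcases h with h | h
    · have h := MvPolynomial.vars_mul _ _ h
      simp at h
    · simp at h
  · intro h
    have h := MvPolynomial.vars_pow _ _ h
    simp at h
  · apply IsRelPrime.pow_right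
    apply IsRelPrime.mul_left
    · apply IsRelPrime.mul_left
      · exact hC.isRelPrime_left
      · exact isRelPrime_X (by decide)
    · exact isRelPrime_X (by decide)

lemma totalDegree_aeval_le (n : ℕ) (g : MvPolynomial (Fin n × Fin n) ℂ) :
    (MvPolynomial.aeval (specMat n) g).totalDegree ≤ g.totalDegree := by
  have hM : ∀ p, (specMat n p).totalDegree ≤ 1 := by
    intro p
    unfold specMat
    split_ifs <;> simp
  rw [MvPolynomial.aeval_def, MvPolynomial.eval₂_eq]
  apply MvPolynomial.totalDegree_finsetSum_le
  intro d hd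
  refine (MvPolynomial.totalDegree_mul _ _).trans ?_
  rw [MvPolynomial.algebraMap_eq, MvPolynomial.totalDegree_C, zero_add]
  refine (MvPolynomial.totalDegree_finsetProd _ _).trans ?_
  refine le_trans ?_ (MvPolynomial.le_totalDegree hd)
  rw [Finsupp.sum]
  apply Finset.sum_le_sum
  intro i _
  refine (MvPolynomial.totalDegree_pow _ _).trans ?_
  simpa using Nat.mul_le_mul_left (d i) (hM i)

lemma totalDegree_sMMvPoly_le (n : ℕ) : (sMMvPoly n).totalDegree ≤ 3 := by
  unfold sMMvPoly
  refine MvPolynomial.totalDegree_finsetSum_le fun i _ => ?_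
  refine MvPolynomial.totalDegree_finsetSum_le fun j _ => ?_
  refine MvPolynomial.totalDegree_finsetSum_le fun k _ => ?_
  refine (MvPolynomial.totalDegree_mul _ _).trans ?_
  have := MvPolynomial.totalDegree_mul (MvPolynomial.X (i, j) : MvPolynomial (Fin n × Fin n) ℂ)
    (MvPolynomial.X (j, k))
  simp only [MvPolynomial.totalDegree_X] at this ⊢
  omega

lemma three_le_totalDegree_specCubic : 3 ≤ specCubic.totalDegree := by
  have h : Finsupp.single (3 : Fin 4) 3 ∈ specCubic.support := by
    rw [MvPolynomial.mem_support_iff, specCubic, MvPolynomial.coeff_add,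
      MvPolynomial.coeff_mul_X', MvPolynomial.coeff_X_pow]
    simp
  simpa using MvPolynomial.le_totalDegree h

theorem sMMvPoly_irreducible (n : ℕ) (hn : 3 ≤ n) : Irreducible (sMMvPoly n) := by
  have hφ := aeval_specMat n hn
  refine ⟨fun h => specCubic_irreducible.not_isUnit (hφ ▸ h.map (MvPolynomial.aeval (specMat n))),
    fun a b hab => ?_⟩
  have hab' : specCubic = MvPolynomial.aeval (specMat n) a * MvPolynomial.aeval (specMat n) b := by
    rw [← hφ, hab, map_mul]
  have h0 : sMMvPoly n ≠ 0 := by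
    intro h
    rw [h, map_zero] at hφ
    exact specCubic_irreducible.ne_zero hφ.symm
  have ha : a ≠ 0 := by rintro rfl; simp [hab] at h0
  have hb : b ≠ 0 := by rintro rfl; simp [hab] at h0
  have h1 := totalDegree_sMMvPoly_le n
  rw [hab, MvPolynomial.totalDegree_mul_of_isDomain ha hb] at h1
  have h2 := three_le_totalDegree_specCubic
  rw [hab'] at h2
  have h3 := h2.trans (MvPolynomial.totalDegree_mul _ _)
  have h4 := totalDegree_aeval_le n a
  have h5 := totalDegree_aeval_le n b
  have key : ∀ c : MvPolynomial (Fin n × Fin n) ℂ, c ≠ 0 → c.totalDegree = 0 → IsUnit c := by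
    intro c hc hd
    rw [MvPolynomial.totalDegree_eq_zero_iff_eq_C] at hd
    rw [hd] at hc ⊢
    exact (IsUnit.mk0 _ (by intro h; simp [h] at hc)).map MvPolynomial.C
  rcases specCubic_irreducible.isUnit_or_isUnit hab' with h | h
  · have := (MvPolynomial.isUnit_iff_totalDegree_of_isReduced.mp h).2
    exact Or.inl (key a ha (by omega))
  · have := (MvPolynomial.isUnit_iff_totalDegree_of_isReduced.mp h).2
    exact Or.inr (key b hb (by omega))
end

section
/- The symmetric border rank of sM_3 satisfies uR_s(sM_3) ≥ 14; that is, the cubic polynomial A ↦ trace(A^3) in the 9 entries of a 3×3 complex matrix does not lie in the closure, in the space of homogeneous cubics in 9 variables, of the set of cubics expressible as a sum of at most 13 cubes of linear forms. -/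
open Filter Matrix

/-- sign of the Koszul matrix -/
def kSg : Fin 10 → Fin 10 → ℤ :=
  ![![0, 0, 0, 0, 0, 0, 0, 1, -1, 1],
    ![0, 0, 0, 0, 0, -1, 1, 0, 0, -1],
    ![0, 0, 0, 0, 1, 0, -1, 0, 1, 0],
    ![0, 0, 0, 0, -1, 1, 0, -1, 0, 0],
    ![0, 0, 1, -1, 0, 0, 0, 0, 0, 1],
    ![0, -1, 0, 1, 0, 0, 0, 0, -1, 0],
    ![0, 1, -1, 0, 0, 0, 0, 1, 0, 0],
    ![1, 0, 0, -1, 0, 0, 1, 0, 0, 0],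
    ![-1, 0, 1, 0, 0, -1, 0, 0, 0, 0],
    ![1, -1, 0, 0, 1, 0, 0, 0, 0, 0]]

/-- variable index of the Koszul matrix -/
def kIx : Fin 10 → Fin 10 → Fin 5 :=
  ![![0, 0, 0, 0, 0, 0, 0, 4, 3, 2],
    ![0, 0, 0, 0, 0, 4, 3, 0, 0, 1],
    ![0, 0, 0, 0, 4, 0, 2, 0, 1, 0],
    ![0, 0, 0, 0, 3, 2, 0, 1, 0, 0],
    ![0, 0, 4, 3, 0, 0, 0, 0, 0, 0],
    ![0, 4, 0, 2, 0, 0, 0, 0, 0, 0],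
    ![0, 3, 2, 0, 0, 0, 0, 0, 0, 0],
    ![4, 0, 0, 1, 0, 0, 0, 0, 0, 0],
    ![3, 0, 1, 0, 0, 0, 0, 0, 0, 0],
    ![2, 1, 0, 0, 0, 0, 0, 0, 0, 0]]

def aInt : Fin 5 → Fin 3 → Fin 3 → ℤ :=
  ![![![1, 0, 0], ![0, -1, 0], ![0, 0, 0]],
    ![![0, 0, 0], ![0, 1, 0], ![0, 0, -1]],
    ![![0, 1, 0], ![0, 0, 0], ![0, 0, 0]],
    ![![0, 0, 0], ![0, 0, 1], ![0, 0, 0]],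
    ![![0, 0, 0], ![0, 0, 0], ![1, 0, 0]]]

def bInt : Fin 9 → Fin 3 → Fin 3 → ℤ :=
  ![![![1, 0, 0], ![0, 1, 0], ![0, 0, 0]],
    ![![-1, 0, 0], ![0, 1, 0], ![0, 0, 1]],
    ![![1, 0, 0], ![0, -1, 0], ![0, 0, 1]],
    ![![0, 1, 0], ![0, 0, 0], ![0, 0, 0]],
    ![![0, 0, 1], ![0, 0, 0], ![0, 0, 0]],
    ![![0, 0, 0], ![1, 0, 0], ![0, 0, 0]],
    ![![0, 0, 0], ![0, 0, 1], ![0, 0, 0]],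
    ![![0, 0, 0], ![0, 0, 0], ![1, 0, 0]],
    ![![0, 0, 0], ![0, 0, 0], ![0, 1, 0]]]

def rowI : Fin 79 → Fin 10 :=
  ![8, 8, 2, 4, 9, 1, 8, 7, 2, 5, 3, 2, 7, 1, 7, 1, 7, 9, 8, 8, 5, 4, 4, 3, 2, 3, 4, 6, 8, 0, 1,
    2, 7, 3, 0, 5, 4, 1, 3, 9, 6, 5, 0, 7, 1, 4, 1, 9, 6, 3, 3, 7, 9, 0, 6, 6, 2, 5, 0, 2, 8, 0, 5,
    7, 1, 3, 9, 4, 7, 4, 0, 6, 5, 9, 3, 0, 5, 6, 0]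

def rowB : Fin 79 → Fin 9 :=
  ![6, 8, 3, 6, 0, 6, 0, 7, 4, 7, 0, 7, 0, 7, 2, 8, 4, 5, 1, 2, 3, 4, 7, 8, 0, 3, 8, 6, 4, 7, 4,
    5, 1, 5, 6, 6, 3, 3, 7, 1, 8, 4, 3, 6, 0, 0, 1, 6, 0, 1, 2, 3, 7, 4, 1, 2, 1, 2, 0, 2, 5, 8, 1,
    8, 5, 6, 4, 1, 5, 2, 1, 5, 5, 8, 4, 2, 8, 3, 5]

def colI : Fin 79 → Fin 10 :=
  ![5, 0, 8, 9, 0, 5, 5, 3, 4, 3, 5, 8, 6, 6, 0, 6, 0, 0, 0, 2, 1, 2, 9, 4, 6, 7, 3, 7, 2, 9, 5,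
    8, 3, 5, 9, 1, 3, 6, 5, 4, 1, 1, 8, 0, 5, 9, 9, 0, 2, 4, 7, 3, 0, 7, 1, 7, 8, 1, 9, 4, 2, 8, 8,
    6, 9, 5, 4, 3, 3, 2, 8, 2, 3, 4, 7, 7, 8, 1, 9]

def colB : Fin 79 → Fin 9 :=
  ![8, 1, 5, 8, 5, 3, 1, 4, 2, 6, 5, 4, 2, 3, 4, 1, 2, 0, 8, 1, 6, 2, 4, 1, 5, 5, 1, 8, 7, 6, 2,
    3, 2, 0, 7, 3, 7, 7, 6, 0, 1, 0, 7, 3, 4, 1, 2, 7, 5, 8, 1, 5, 6, 2, 8, 0, 2, 4, 5, 4, 3, 1, 0,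
    6, 3, 7, 7, 8, 3, 4, 8, 0, 0, 6, 7, 4, 6, 7, 0]

def tInt (k : Fin 5) (b c : Fin 9) : ℤ :=
  ∑ i, ∑ j, ∑ l, (aInt k i j * bInt b j l * bInt c l i + aInt k i j * bInt c j l * bInt b l i)

def fInt (i j : Fin 79) : ℤ :=
  if kSg (rowI i) (colI j) = 0 then 0
  else kSg (rowI i) (colI j) * tInt (kIx (rowI i) (colI j)) (rowB i) (colB j)

theorem fInt_tri : ∀ i j : Fin 79, j < i → fInt i j = 0 := by
  decide +kernel

theorem fInt_diag : ∀ i : Fin 79, fInt i i ≠ 0 := by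
  decide +kernel

/-- the flattening of a trilinear table -/
noncomputable def flatM (t : Fin 5 → Fin 9 → Fin 9 → ℂ) : Matrix (Fin 79) (Fin 79) ℂ :=
  fun i j => (kSg (rowI i) (colI j) : ℂ) * t (kIx (rowI i) (colI j)) (rowB i) (colB j)

theorem flatM_det_ne : (flatM fun k b c => (tInt k b c : ℂ) / 2).det ≠ 0 := by
  have h : ∀ i j, flatM (fun k b c => (tInt k b c : ℂ) / 2) i j = (fInt i j : ℂ) / 2 := by
    intro i j
    unfold flatM fInt
    split_ifs with h
    · simp [h]
    · push_cast; ring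
  rw [Matrix.det_of_isUpperTriangular]
  · rw [Finset.prod_ne_zero_iff]
    intro i _
    rw [h]
    have := fInt_diag i
    simpa using this
  · intro i j hij
    rw [h, fInt_tri i j hij]
    simp

noncomputable def kMat (x : Fin 5 → ℂ) (I J : Fin 10) : ℂ := (kSg I J : ℂ) * x (kIx I J)

/-- the pairs -/
def prL : Fin 10 → Fin 5 := ![0, 0, 0, 0, 1, 1, 1, 2, 2, 3]
def prR : Fin 10 → Fin 5 := ![1, 2, 3, 4, 2, 3, 4, 3, 4, 4]

/-- the six pairs avoiding `k` -/
def avoid : Fin 5 → Fin 6 → Fin 10 :=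
  ![![4, 5, 6, 7, 8, 9], ![1, 2, 3, 7, 8, 9], ![0, 2, 3, 5, 6, 9], ![0, 1, 3, 4, 6, 8],
    ![0, 1, 2, 4, 5, 7]]

/-- the scaled substitution vectors -/
noncomputable def subV (x : Fin 5 → ℂ) (k p a : Fin 5) : ℂ :=
  (if p = a then x k else 0) - (if p = k then x a else 0)

set_option maxHeartbeats 4000000 in
theorem kMat_id0 (x : Fin 5 → ℂ) (I J : Fin 10) :
    x 0 ^ 2 * kMat x I J = ∑ s, kMat x I (avoid 0 s) *
      (subV x 0 (prL J) (prL (avoid 0 s)) * subV x 0 (prR J) (prR (avoid 0 s)) -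
      subV x 0 (prL J) (prR (avoid 0 s)) * subV x 0 (prR J) (prL (avoid 0 s))) := by
  rw [Fin.sum_univ_six]
  fin_cases J <;> simp [subV, avoid, prL, prR, -mul_eq_mul_left_iff, -mul_eq_mul_right_iff] <;> fin_cases I <;>
    simp [kMat, kSg, kIx, -mul_eq_mul_left_iff, -mul_eq_mul_right_iff, -mul_eq_zero, -zero_eq_mul] <;> ring

set_option maxHeartbeats 4000000 in
theorem kMat_id1 (x : Fin 5 → ℂ) (I J : Fin 10) :
    x 1 ^ 2 * kMat x I J = ∑ s, kMat x I (avoid 1 s) *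
      (subV x 1 (prL J) (prL (avoid 1 s)) * subV x 1 (prR J) (prR (avoid 1 s)) -
      subV x 1 (prL J) (prR (avoid 1 s)) * subV x 1 (prR J) (prL (avoid 1 s))) := by
  rw [Fin.sum_univ_six]
  fin_cases J <;> simp [subV, avoid, prL, prR, -mul_eq_mul_left_iff, -mul_eq_mul_right_iff] <;> fin_cases I <;>
    simp [kMat, kSg, kIx, -mul_eq_mul_left_iff, -mul_eq_mul_right_iff, -mul_eq_zero, -zero_eq_mul] <;> ring

set_option maxHeartbeats 4000000 in
theorem kMat_id2 (x : Fin 5 → ℂ) (I J : Fin 10) :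
    x 2 ^ 2 * kMat x I J = ∑ s, kMat x I (avoid 2 s) *
      (subV x 2 (prL J) (prL (avoid 2 s)) * subV x 2 (prR J) (prR (avoid 2 s)) -
      subV x 2 (prL J) (prR (avoid 2 s)) * subV x 2 (prR J) (prL (avoid 2 s))) := by
  rw [Fin.sum_univ_six]
  fin_cases J <;> simp [subV, avoid, prL, prR, -mul_eq_mul_left_iff, -mul_eq_mul_right_iff] <;> fin_cases I <;>
    simp [kMat, kSg, kIx, -mul_eq_mul_left_iff, -mul_eq_mul_right_iff, -mul_eq_zero, -zero_eq_mul] <;> ring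

set_option maxHeartbeats 4000000 in
theorem kMat_id3 (x : Fin 5 → ℂ) (I J : Fin 10) :
    x 3 ^ 2 * kMat x I J = ∑ s, kMat x I (avoid 3 s) *
      (subV x 3 (prL J) (prL (avoid 3 s)) * subV x 3 (prR J) (prR (avoid 3 s)) -
      subV x 3 (prL J) (prR (avoid 3 s)) * subV x 3 (prR J) (prL (avoid 3 s))) := by
  rw [Fin.sum_univ_six]
  fin_cases J <;> simp [subV, avoid, prL, prR, -mul_eq_mul_left_iff, -mul_eq_mul_right_iff] <;> fin_cases I <;>
    simp [kMat, kSg, kIx, -mul_eq_mul_left_iff, -mul_eq_mul_right_iff, -mul_eq_zero, -zero_eq_mul] <;> ring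

set_option maxHeartbeats 4000000 in
theorem kMat_id4 (x : Fin 5 → ℂ) (I J : Fin 10) :
    x 4 ^ 2 * kMat x I J = ∑ s, kMat x I (avoid 4 s) *
      (subV x 4 (prL J) (prL (avoid 4 s)) * subV x 4 (prR J) (prR (avoid 4 s)) -
      subV x 4 (prL J) (prR (avoid 4 s)) * subV x 4 (prR J) (prL (avoid 4 s))) := by
  rw [Fin.sum_univ_six]
  fin_cases J <;> simp [subV, avoid, prL, prR, -mul_eq_mul_left_iff, -mul_eq_mul_right_iff] <;> fin_cases I <;>
    simp [kMat, kSg, kIx, -mul_eq_mul_left_iff, -mul_eq_mul_right_iff, -mul_eq_zero, -zero_eq_mul] <;> ring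

theorem kMat_factor (x : Fin 5 → ℂ) : ∃ (U : Fin 10 → Fin 6 → ℂ) (V : Fin 6 → Fin 10 → ℂ),
    ∀ I J, kMat x I J = ∑ s, U I s * V s J := by
  by_cases hx : ∃ k, x k ≠ 0
  · obtain ⟨k, hk⟩ := hx
    refine ⟨fun I s => kMat x I (avoid k s), fun s J =>
      (subV x k (prL J) (prL (avoid k s)) * subV x k (prR J) (prR (avoid k s)) -
      subV x k (prL J) (prR (avoid k s)) * subV x k (prR J) (prL (avoid k s))) / x k ^ 2, ?_⟩
    intro I J
    simp only [← mul_div_assoc, ← Finset.sum_div]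
    rw [eq_div_iff (pow_ne_zero 2 hk), mul_comm]
    fin_cases k
    · exact kMat_id0 x I J
    · exact kMat_id1 x I J
    · exact kMat_id2 x I J
    · exact kMat_id3 x I J
    · exact kMat_id4 x I J
  · push Not at hx
    exact ⟨fun _ _ => 0, fun _ _ => 0, fun I J => by simp [kMat, hx]⟩

theorem flatM_det_zero {r : ℕ} (hr : r < 14) (x : Fin r → Fin 5 → ℂ) (y : Fin r → Fin 9 → ℂ) :
    (flatM fun k b c => ∑ i, x i k * y i b * y i c).det = 0 := by
  choose U V hUV using fun i => kMat_factor (x i)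
  let UU : Matrix (Fin 79) (Fin r × Fin 6) ℂ := fun i p => U p.1 (rowI i) p.2 * y p.1 (rowB i)
  let VV : Matrix (Fin r × Fin 6) (Fin 79) ℂ := fun p j => V p.1 p.2 (colI j) * y p.1 (colB j)
  have hF : (flatM fun k b c => ∑ i, x i k * y i b * y i c) = UU * VV := by
    ext i j
    rw [Matrix.mul_apply, Fintype.sum_prod_type]
    unfold flatM
    rw [Finset.mul_sum]
    refine Finset.sum_congr rfl fun q _ => ?_
    have := hUV q (rowI i) (colI j)
    calc _ = kMat (x q) (rowI i) (colI j) * (y q (rowB i) * y q (colB j)) := by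
          unfold kMat; ring
      _ = _ := by
          rw [this, Finset.sum_mul]
          refine Finset.sum_congr rfl fun s _ => ?_
          simp only [UU, VV]; ring
  by_contra hne
  have h1 := Matrix.rank_of_isUnit _ ((Matrix.isUnit_iff_isUnit_det _).2 (isUnit_iff_ne_zero.2 hne))
  rw [hF] at h1
  have h2 := (Matrix.rank_mul_le_left UU VV).trans (Matrix.rank_le_card_width UU)
  rw [h1] at h2
  simp at h2
  omega

noncomputable def aC (k : Fin 5) : Matrix (Fin 3) (Fin 3) ℂ := fun i j => (aInt k i j : ℂ)
noncomputable def bC (k : Fin 9) : Matrix (Fin 3) (Fin 3) ℂ := fun i j => (bInt k i j : ℂ)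

theorem polar (A B C : Matrix (Fin 3) (Fin 3) ℂ) :
    (sMPoly 3 (A + B + C) - sMPoly 3 (A + B - C) - sMPoly 3 (A - B + C) - sMPoly 3 (-A + B + C)) / 24
      = ((A * B * C).trace + (A * C * B).trace) / 2 := by
  simp only [sMPoly, Matrix.trace, Matrix.diag, pow_succ, pow_zero, one_mul, Matrix.mul_apply,
    Fin.sum_univ_three, Matrix.add_apply, Matrix.sub_apply, Matrix.neg_apply]
  ring

theorem trace_eq (k : Fin 5) (b c : Fin 9) :
    ((aC k * bC b * bC c).trace + (aC k * bC c * bC b).trace) / 2 = (tInt k b c : ℂ) / 2 := by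
  simp only [tInt, Matrix.trace, Matrix.diag, Matrix.mul_apply, aC, bC, Fin.sum_univ_three]
  push_cast
  ring

theorem lower {r : ℕ} (hr : r < 14) (ℓ : ℕ → Fin r → (Matrix (Fin 3) (Fin 3) ℂ →ₗ[ℂ] ℂ))
    (h : ∀ a, Tendsto (fun m => ∑ i, (ℓ m i a) ^ 3) atTop (nhds (sMPoly 3 a))) : False := by
  have ht : ∀ k b c, Tendsto (fun m => ∑ i, ℓ m i (aC k) * ℓ m i (bC b) * ℓ m i (bC c)) atTop
      (nhds ((tInt k b c : ℂ) / 2)) := by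
    intro k b c
    rw [← trace_eq, ← polar]
    refine (((((h _).sub (h _)).sub (h _)).sub (h _)).div_const 24).congr fun m => ?_
    simp only [← Finset.sum_sub_distrib, Finset.sum_div]
    refine Finset.sum_congr rfl fun i _ => ?_
    simp only [map_add, map_sub, map_neg]
    ring
  have hF : Tendsto (fun m => flatM fun k b c => ∑ i, ℓ m i (aC k) * ℓ m i (bC b) * ℓ m i (bC c))
      atTop (nhds (flatM fun k b c => (tInt k b c : ℂ) / 2)) := by
    refine tendsto_pi_nhds.2 fun i => tendsto_pi_nhds.2 fun j => ?_
    exact (ht _ _ _).const_mul _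
  have hc : Continuous (fun M : Matrix (Fin 79) (Fin 79) ℂ => M.det) := continuous_id.matrix_det
  have hdet := (hc.tendsto _).comp hF
  have h0 : (fun M : Matrix (Fin 79) (Fin 79) ℂ => M.det) ∘
      (fun m => flatM fun k b c => ∑ i, ℓ m i (aC k) * ℓ m i (bC b) * ℓ m i (bC c)) =
      fun _ => 0 := by
    funext m
    rw [Function.comp_apply]
    apply flatM_det_zero hr (fun i k => ℓ m i (aC k)) (fun i b => ℓ m i (bC b))
  rw [h0] at hdet
  have h1 := tendsto_nhds_unique hdet tendsto_const_nhds
  exact flatM_det_ne h1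

noncomputable def entryL (i j : Fin 3) : Matrix (Fin 3) (Fin 3) ℂ →ₗ[ℂ] ℂ :=
  Matrix.entryLinearMap ℂ ℂ i j

theorem upper : ∃ r : ℕ, ∃ ℓ : ℕ → Fin r → (Matrix (Fin 3) (Fin 3) ℂ →ₗ[ℂ] ℂ),
    ∀ a, Tendsto (fun m => ∑ i, (ℓ m i a) ^ 3) atTop (nhds (sMPoly 3 a)) := by
  obtain ⟨α, hα⟩ := IsAlgClosed.exists_pow_nat_eq (1 / 24 : ℂ) (n := 3) (by norm_num)
  let g : (Fin 3 × Fin 3 × Fin 3) × Fin 4 → (Matrix (Fin 3) (Fin 3) ℂ →ₗ[ℂ] ℂ) := fun p =>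
    let x := entryL p.1.1 p.1.2.1
    let y := entryL p.1.2.1 p.1.2.2
    let z := entryL p.1.2.2 p.1.1
    ![α • (x + y + z), (-α) • (x + y - z), (-α) • (x - y + z), (-α) • (-x + y + z)] p.2
  refine ⟨_, fun _ i => g ((Fintype.equivFin _).symm i), fun a => ?_⟩
  refine tendsto_const_nhds.congr fun _ => ?_
  rw [Equiv.sum_comp (Fintype.equivFin _).symm (fun p => (g p a) ^ 3)]
  rw [Fintype.sum_prod_type]
  have : ∀ q : Fin 3 × Fin 3 × Fin 3, ∑ s, (g (q, s) a) ^ 3 = a q.1 q.2.1 * a q.2.1 q.2.2 * a q.2.2 q.1 := by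
    intro q
    simp [g, Fin.sum_univ_four, entryL]
    have h3 : (-α) ^ 3 = -(1 / 24) := by rw [Odd.neg_pow (by decide), hα]
    try simp only [neg_pow, hα]
    ring_nf
    try simp only [hα]
    try ring
  rw [Finset.sum_congr rfl (fun q _ => this q)]
  simp only [Fintype.sum_prod_type, sMPoly, Matrix.trace, Matrix.diag, pow_succ, pow_zero,
    one_mul, Matrix.mul_apply, Fin.sum_univ_three]
  ring

theorem symBorderRank_sM3_ge : 14 ≤ symBorderRank (sMPoly 3) := by
  by_contra hlt
  push Not at hlt
  obtain ⟨ℓ, hℓ⟩ := Nat.sInf_mem (s := {r : ℕ | ∃ ℓ : ℕ → Fin r → (Matrix (Fin 3) (Fin 3) ℂ →ₗ[ℂ] ℂ),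
    ∀ a, Tendsto (fun m => ∑ i, (ℓ m i a) ^ 3) atTop (nhds (sMPoly 3 a))}) upper
  exact lower hlt ℓ hℓ
end
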